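/- Let k>0 and let W = [0,∞)³ ⊂ ℝ³ be the closed first octant. Let q : ℝ³ → ℂ be bounded measurable with q = 1 on ℝ³ \ W, with q−1 compactly supported, and suppose there exist r>0, α>1/4, C≥0 such that |q(x)−q(y)| ≤ C|x−y|^α for all x,y ∈ W ∩ B(0,r), and q(0) ≠ 1. Let u, u^in : ℝ³ → ℂ be C² functions with Δu^in + k²u^in = 0 and Δu + k²qu = 0 pointwise on ℝ³, and suppose u = u^in on ℝ³ \ W. Then u^in ≡ 0 on ℝ³. -/

import Mathlib

open MeasureTheory Metric Set Real

/-- The Euclidean Laplacian of a function `u : ℝ³ → ℂ`: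
`Δu(x) = ∑ i, ∂²u/∂xᵢ²(x)`. -/
noncomputable def laplacian3 (u : EuclideanSpace ℝ (Fin 3) → ℂ)
    (x : EuclideanSpace ℝ (Fin 3)) : ℂ :=
  ∑ i : Fin 3,
    fderiv ℝ (fun y => fderiv ℝ u y (EuclideanSpace.single i (1 : ℝ))) x
      (EuclideanSpace.single i (1 : ℝ))

/-- The closed first octant `[0,∞)³` in ℝ³. -/
def octant : Set (EuclideanSpace ℝ (Fin 3)) := {x | ∀ i, 0 ≤ x i}

/-- directional derivative -/
noncomputable def pd {V F : Type*} [NormedAddCommGroup V] [NormedSpace ℝ V]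
    [NormedAddCommGroup F] [NormedSpace ℝ F] (v : V) (f : V → F) : V → F :=
  fun x => fderiv ℝ f x v

section PD
variable {V : Type*} [NormedAddCommGroup V] [NormedSpace ℝ V]
variable {F : Type*} [NormedAddCommGroup F] [NormedSpace ℝ F]
variable {𝕜 : Type*} [RCLike 𝕜]

theorem pd_contDiff {n m : WithTop ℕ∞} {f : V → F} (hf : ContDiff ℝ n f) (h : m + 1 ≤ n) (v : V) :
    ContDiff ℝ m (pd v f) := by
  have := hf.fderiv_right (m := m) h
  exact this.clm_apply contDiff_const

theorem pd_contDiff_one {f : V → F} (hf : ContDiff ℝ 2 f) (v : V) :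
    ContDiff ℝ 1 (pd v f) := pd_contDiff hf (by norm_num) v

theorem pd_continuous {f : V → F} (hf : ContDiff ℝ 1 f) (v : V) : Continuous (pd v f) :=
  (pd_contDiff (m := 0) hf (by norm_num) v).continuous

theorem pd_support {f : V → F} (hf : HasCompactSupport f) (v : V) :
    HasCompactSupport (pd v f) := hf.fderiv_apply (𝕜 := ℝ) v

theorem pd_mul {f g : V → 𝕜} (hf : Differentiable ℝ f) (hg : Differentiable ℝ g) (v : V) :
    pd v (fun x => f x * g x) = fun x => pd v f x * g x + f x * pd v g x := by
  ext x
  simp only [pd]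
  rw [fderiv_fun_mul (hf x) (hg x)]
  simp
  ring

theorem pd_add {f g : V → F} (hf : Differentiable ℝ f) (hg : Differentiable ℝ g) (v : V) :
    pd v (fun x => f x + g x) = fun x => pd v f x + pd v g x := by
  ext x
  simp only [pd]
  rw [fderiv_fun_add (hf x) (hg x)]
  simp

theorem pd_sub {f g : V → F} (hf : Differentiable ℝ f) (hg : Differentiable ℝ g) (v : V) :
    pd v (fun x => f x - g x) = fun x => pd v f x - pd v g x := by
  ext x
  simp only [pd]
  rw [fderiv_fun_sub (hf x) (hg x)]
  simp

theorem pd_const_mul {f : V → 𝕜} (hf : Differentiable ℝ f) (c : 𝕜) (v : V) :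
    pd v (fun x => c * f x) = fun x => c * pd v f x := by
  ext x
  simp only [pd]
  rw [fderiv_const_mul (hf x) c]
  simp

theorem pd_clm {G : Type*} [NormedAddCommGroup G] [NormedSpace ℝ G]
    {f : V → F} (hf : Differentiable ℝ f) (L : F →L[ℝ] G) (v : V) :
    pd v (fun x => L (f x)) = fun x => L (pd v f x) := by
  ext x
  simp only [pd]
  have := (L.hasFDerivAt (x := f x)).comp x (hf x).hasFDerivAt
  have h2 := this.fderiv
  simp only [Function.comp_def] at h2
  rw [h2]; simp

theorem pd_comm {f : V → F} (hf : ContDiff ℝ 2 f) (v w : V) :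
    pd v (pd w f) = pd w (pd v f) := by
  ext x
  have hd : Differentiable ℝ (fderiv ℝ f) :=
    (hf.fderiv_right (m := 1) (by norm_num)).differentiable (by norm_num)
  have key : ∀ a b : V, pd a (pd b f) x = fderiv ℝ (fderiv ℝ f) x a b := by
    intro a b
    change fderiv ℝ (fun y => (fderiv ℝ f y) b) x a = _
    have := ((hd x).hasFDerivAt.clm_apply (hasFDerivAt_const b x)).fderiv
    rw [this]; simp
  rw [key, key]
  have := hf.contDiffAt.isSymmSndFDerivAt (x := x) (by simp)
  exact this v w

variable [FiniteDimensional ℝ V] [MeasurableSpace V] [BorelSpace V] {μ : Measure V}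
  [μ.IsAddHaarMeasure]

theorem integral_pd_mul {f g : V → 𝕜} (hf : ContDiff ℝ 1 f) (hg : ContDiff ℝ 1 g)
    (hc : HasCompactSupport g) (v : V) :
    ∫ x, f x * pd v g x ∂μ = - ∫ x, pd v f x * g x ∂μ := by
  apply integral_mul_fderiv_eq_neg_fderiv_mul_of_integrable
  · exact ((pd_continuous hf v).mul hg.continuous).integrable_of_hasCompactSupport
      (hc.mul_left)
  · exact (hf.continuous.mul (pd_continuous hg v)).integrable_of_hasCompactSupport
      ((pd_support hc v).mul_left)
  · exact (hf.continuous.mul hg.continuous).integrable_of_hasCompactSupport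
      (hc.mul_left)
  · intro x _; exact hf.differentiable (by norm_num) x
  · intro x _; exact hg.differentiable (by norm_num) x

theorem integral_pd {g : V → 𝕜} (hg : ContDiff ℝ 1 g)
    (hc : HasCompactSupport g) (v : V) :
    ∫ x, pd v g x ∂μ = 0 := by
  have := integral_pd_mul (μ := μ) (contDiff_const (c := (1:𝕜))) hg hc v
  simpa [pd] using this

end PD

section LAP
variable {n : ℕ} {𝕜 : Type*} [RCLike 𝕜]

/-- coordinate vector -/
noncomputable abbrev ei {n : ℕ} (i : Fin n) : EuclideanSpace ℝ (Fin n) :=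
  EuclideanSpace.single i (1 : ℝ)

noncomputable def lap (f : EuclideanSpace ℝ (Fin n) → 𝕜) : EuclideanSpace ℝ (Fin n) → 𝕜 :=
  fun x => ∑ i, pd (ei i) (pd (ei i) f) x

theorem laplacian3_eq (u : EuclideanSpace ℝ (Fin 3) → ℂ) : laplacian3 u = lap u := rfl

theorem lap_continuous {f : EuclideanSpace ℝ (Fin n) → 𝕜} (hf : ContDiff ℝ 2 f) :
    Continuous (lap f) :=
  continuous_finsetSum _ fun _ _ => pd_continuous (pd_contDiff_one hf _) _

theorem lap_mul {f g : EuclideanSpace ℝ (Fin n) → 𝕜} (hf : ContDiff ℝ 2 f) (hg : ContDiff ℝ 2 g) :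
    lap (fun x => f x * g x) = fun x => lap f x * g x
      + 2 * ∑ i, pd (ei i) f x * pd (ei i) g x + f x * lap g x := by
  have hf' := hf.differentiable (by norm_num)
  have hg' := hg.differentiable (by norm_num)
  have hf'' := fun i : Fin n => (pd_contDiff_one hf (ei i)).differentiable (by norm_num)
  have hg'' := fun i : Fin n => (pd_contDiff_one hg (ei i)).differentiable (by norm_num)
  ext x
  simp only [lap]
  rw [Finset.sum_mul, Finset.mul_sum, Finset.mul_sum, ← Finset.sum_add_distrib,
    ← Finset.sum_add_distrib]
  refine Finset.sum_congr rfl fun i _ => ?_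
  rw [pd_mul hf' hg', pd_add (f := fun x => pd (ei i) f x * g x) (g := fun x => f x * pd (ei i) g x)
      ((hf'' i).mul hg') (hf'.mul (hg'' i)), pd_mul (hf'' i) hg',
    pd_mul hf' (hg'' i)]
  ring

theorem lap_sub {f g : EuclideanSpace ℝ (Fin n) → 𝕜} (hf : ContDiff ℝ 2 f) (hg : ContDiff ℝ 2 g) :
    lap (fun x => f x - g x) = fun x => lap f x - lap g x := by
  have hf' := hf.differentiable (by norm_num)
  have hg' := hg.differentiable (by norm_num)
  have hf'' := fun i : Fin n => (pd_contDiff_one hf (ei i)).differentiable (by norm_num)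
  have hg'' := fun i : Fin n => (pd_contDiff_one hg (ei i)).differentiable (by norm_num)
  ext x
  simp only [lap]
  rw [← Finset.sum_sub_distrib]
  refine Finset.sum_congr rfl fun i _ => ?_
  rw [pd_sub hf' hg', pd_sub (hf'' i) (hg'' i)]

theorem integral_lap_mul {f g : EuclideanSpace ℝ (Fin n) → 𝕜} (hf : ContDiff ℝ 2 f)
    (hg : ContDiff ℝ 2 g) (hc : HasCompactSupport g) :
    ∫ x, f x * lap g x = ∫ x, lap f x * g x := by
  have hf1 : ContDiff ℝ 1 f := hf.of_le (by norm_num)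
  have hg1 : ContDiff ℝ 1 g := hg.of_le (by norm_num)
  simp only [lap, Finset.mul_sum, Finset.sum_mul]
  rw [integral_finsetSum, integral_finsetSum]
  · refine Finset.sum_congr rfl fun i _ => ?_
    rw [integral_pd_mul hf1 (pd_contDiff_one hg _) (pd_support hc _),
      integral_pd_mul (pd_contDiff_one hf _) hg1 hc, neg_neg]
  · intro i _
    exact ((pd_continuous (pd_contDiff_one hf _) _).mul hg.continuous).integrable_of_hasCompactSupport
      (hc.mul_left)
  · intro i _
    exact (hf.continuous.mul (pd_continuous (pd_contDiff_one hg _) _)).integrable_of_hasCompactSupport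
      ((pd_support (pd_support hc _) _).mul_left)
end LAP

/-- sum of coordinates -/
noncomputable def sL : EuclideanSpace ℝ (Fin 3) →L[ℝ] ℝ :=
  ∑ i : Fin 3, EuclideanSpace.proj i

theorem sL_apply (x : EuclideanSpace ℝ (Fin 3)) : sL x = ∑ i, x i := by
  simp [sL]

theorem sL_ei (i : Fin 3) : sL (ei i) = 1 := by
  rw [sL_apply]; simp

noncomputable def e111 : EuclideanSpace ℝ (Fin 3) := ∑ i : Fin 3, ei i

theorem sL_e111 : sL e111 = 3 := by
  simp [e111, map_sum, sL_ei]

theorem pd_e111 {F : Type*} [NormedAddCommGroup F] [NormedSpace ℝ F]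
    (f : EuclideanSpace ℝ (Fin 3) → F) (x) : pd e111 f x = ∑ i : Fin 3, pd (ei i) f x := by
  simp only [pd, e111, map_sum]

theorem pd_sL (v : EuclideanSpace ℝ (Fin 3)) : pd v (fun x => sL x) = fun _ => sL v := by
  ext x
  simp only [pd]
  rw [sL.hasFDerivAt.fderiv]

theorem abs_sL_le (x : EuclideanSpace ℝ (Fin 3)) : |sL x| ≤ 3 * ‖x‖ := by
  rw [sL_apply]
  calc |∑ i, x i| ≤ ∑ i : Fin 3, |x i| := Finset.abs_sum_le_sum_abs _ _
    _ ≤ ∑ i : Fin 3, ‖x‖ := Finset.sum_le_sum fun i _ => by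
        simpa using PiLp.norm_apply_le x i
    _ = 3 * ‖x‖ := by simp

theorem pd_exp (τ : ℝ) (v : EuclideanSpace ℝ (Fin 3)) :
    pd v (fun x => Real.exp (τ * sL x)) = fun x => (τ * sL v) * Real.exp (τ * sL x) := by
  ext x
  simp only [pd]
  have h := ((sL.hasFDerivAt (x := x)).const_mul τ).exp.fderiv
  rw [h]; simp; ring

theorem exp_contDiff (τ : ℝ) {n : WithTop ℕ∞}: ContDiff ℝ n (fun x => Real.exp (τ * sL x)) :=
  (contDiff_const.mul sL.contDiff).exp

theorem lap_exp (τ : ℝ) :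
    lap (fun x => Real.exp (τ * sL x)) = fun x => 3 * τ ^ 2 * Real.exp (τ * sL x) := by
  ext x
  simp only [lap]
  have : ∀ i : Fin 3, pd (ei i) (pd (ei i) (fun x => Real.exp (τ * sL x))) x
      = τ ^ 2 * Real.exp (τ * sL x) := by
    intro i
    rw [pd_exp, pd_const_mul ((exp_contDiff τ (n := 1)).differentiable (by norm_num)), pd_exp]
    simp only [sL_ei]; ring
  simp only [this, Finset.sum_const, Finset.card_univ, Fintype.card_fin, nsmul_eq_mul]
  push_cast; ring

theorem integral_self_pd {g : EuclideanSpace ℝ (Fin 3) → ℝ} (hg : ContDiff ℝ 1 g)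
    (hc : HasCompactSupport g) (v) : ∫ x, g x * pd v g x = 0 := by
  have h := integral_pd_mul (μ := volume) hg hg hc v
  have h2 : ∫ x, pd v g x * g x = ∫ x, g x * pd v g x := by
    congr 1; ext x; ring
  rw [h2] at h; linarith

theorem carleman_real (R τ : ℝ) (hR : 0 ≤ R) (hτ : 0 < τ) (v : EuclideanSpace ℝ (Fin 3) → ℝ)
    (hv : ContDiff ℝ 2 v) (hc : HasCompactSupport v) (hsupp : ∀ x, v x ≠ 0 → ‖x‖ ≤ R) :
    ∫ x, (Real.exp (-τ * sL x) * v x) ^ 2 ≤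
      (2 * R ^ 2 / τ ^ 2) * ∫ x, (Real.exp (-τ * sL x) * lap v x) ^ 2 := by
  set g : EuclideanSpace ℝ (Fin 3) → ℝ := fun x => Real.exp (-τ * sL x) * v x with hgdef
  have hg : ContDiff ℝ 2 g := (exp_contDiff (-τ)).mul hv
  have hg1 : ContDiff ℝ 1 g := hg.of_le (by norm_num)
  have hgc : HasCompactSupport g := hc.mul_left
  set h := pd e111 g with hh
  have hhC : ContDiff ℝ 1 h := pd_contDiff_one hg _
  have hhc : HasCompactSupport h := pd_support hgc _
  have hgs : ∀ x, g x ≠ 0 → ‖x‖ ≤ R := fun x hx => hsupp x (by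
    intro h0; apply hx; simp [hgdef, h0])
  set w : EuclideanSpace ℝ (Fin 3) → ℝ := fun x => Real.exp (-τ * sL x) * lap v x with hw
  have hveq : v = fun x => Real.exp (τ * sL x) * g x := by
    ext x; simp only [hgdef, ← mul_assoc, ← Real.exp_add]; simp
  have hweq : ∀ x, w x = lap g x + 2 * τ * h x + 3 * τ ^ 2 * g x := by
    intro x
    have h1 : lap v x = Real.exp (τ * sL x) * (lap g x + 2 * τ * h x + 3 * τ ^ 2 * g x) := by
      conv_lhs => rw [hveq]
      rw [lap_mul (exp_contDiff τ) hg, lap_exp]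
      simp only [pd_exp, sL_ei, hh, pd_e111]
      rw [Finset.mul_sum, Finset.mul_sum, mul_add, mul_add, Finset.mul_sum]
      have : ∀ i : Fin 3, 2 * (τ * 1 * Real.exp (τ * sL x) * pd (ei i) g x) =
        Real.exp (τ * sL x) * (2 * τ * pd (ei i) g x) := by intro i; ring
      simp only [this]; ring
    simp only [hw]
    rw [h1, ← mul_assoc, ← Real.exp_add]; simp
  have hwcont : Continuous w := ((exp_contDiff (-τ) (n := 1)).continuous).mul (lap_continuous hv)
  have hgcont := hg.continuous
  have hhcont := hhC.continuous
  have lc := lap_continuous hg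
  have int1 : ∀ F : EuclideanSpace ℝ (Fin 3) → ℝ, Continuous F → Integrable (fun x => F x * h x) :=
    fun F hF => (hF.mul hhcont).integrable_of_hasCompactSupport hhc.mul_left
  have int2 : ∀ F : EuclideanSpace ℝ (Fin 3) → ℝ, Continuous F → Integrable (fun x => F x * g x) :=
    fun F hF => (hF.mul hgcont).integrable_of_hasCompactSupport hgc.mul_left
  have hlapc : HasCompactSupport (lap v) := by
    have : ∀ i : Fin 3, HasCompactSupport (pd (ei i) (pd (ei i) v)) :=
      fun i => pd_support (pd_support hc _) _
    have e : lap v = fun x => pd (ei 0) (pd (ei 0) v) x + pd (ei 1) (pd (ei 1) v) x +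
      pd (ei 2) (pd (ei 2) v) x := by ext x; simp [lap, Fin.sum_univ_three]
    rw [e]; exact ((this 0).add (this 1)).add (this 2)
  have hwc : HasCompactSupport w := hlapc.mul_left
  have intw : Integrable (fun x => w x * w x) :=
    (hwcont.mul hwcont).integrable_of_hasCompactSupport hwc.mul_left
  -- ∫ lap g * h = 0
  have z1 : ∫ x, g x * h x = 0 := integral_self_pd hg1 hgc _
  have z2 : ∫ x, lap g x * h x = 0 := by
    simp only [lap, Finset.sum_mul]
    rw [integral_finsetSum]
    · refine Finset.sum_eq_zero fun i _ => ?_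
      have a := integral_pd_mul (μ := volume) hhC (pd_contDiff_one hg (ei i)) (pd_support hgc _) (ei i)
      rw [hh, pd_comm hg (ei i) e111] at a
      have b := integral_self_pd (pd_contDiff_one hg (ei i)) (pd_support hgc _) e111
      calc ∫ x, pd (ei i) (pd (ei i) g) x * h x = ∫ x, pd e111 g x * pd (ei i) (pd (ei i) g) x := by
            congr 1; ext x; rw [hh]; ring
        _ = - ∫ x, pd e111 (pd (ei i) g) x * pd (ei i) g x := a
        _ = - ∫ x, pd (ei i) g x * pd e111 (pd (ei i) g) x := by
            congr 2; ext x; ring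
        _ = 0 := by rw [b]; simp
    · intro i _
      exact int1 _ (pd_continuous (pd_contDiff_one hg _) _)
  have z3 : ∫ x, w x * h x = 2 * τ * ∫ x, h x * h x := by
    have : ∀ x, w x * h x = lap g x * h x + (2 * τ) * (h x * h x) + (3 * τ ^ 2) * (g x * h x) := by
      intro x; rw [hweq]; ring
    simp only [this]
    have i1 : Integrable (fun x => lap g x * h x + (2 * τ) * (h x * h x)) :=
      (int1 _ lc).add ((int1 _ hhcont).const_mul _)
    rw [integral_add i1 ((int1 _ hgcont).const_mul _),
      integral_add (int1 _ lc) ((int1 _ hhcont).const_mul _), integral_const_mul, integral_const_mul,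
      z1, z2]
    ring
  have z4 : 4 * τ ^ 2 * ∫ x, h x * h x ≤ ∫ x, w x * w x := by
    have p : 0 ≤ ∫ x, (w x * w x - (4 * τ) * (w x * h x) + (4 * τ ^ 2) * (h x * h x)) := by
      apply integral_nonneg; intro x
      have : 0 ≤ (w x - 2 * τ * h x) ^ 2 := sq_nonneg _
      simp only [Pi.zero_apply]
      nlinarith
    have i1 : Integrable (fun x => w x * w x - (4 * τ) * (w x * h x)) :=
      intw.sub ((int1 _ hwcont).const_mul _)
    rw [integral_add i1 ((int1 _ hhcont).const_mul _),
      integral_sub intw ((int1 _ hwcont).const_mul _), integral_const_mul, integral_const_mul, z3] at p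
    nlinarith
  have z5 : 2 * ∫ x, g x * g x ≤ 9 * R ^ 2 * ∫ x, h x * h x := by
    have hsd : Differentiable ℝ (fun x => sL x) := sL.differentiable
    have hgd : Differentiable ℝ g := hg1.differentiable (by norm_num)
    have hC : ContDiff ℝ 1 (fun x => sL x * (g x * g x)) := sL.contDiff.mul (hg1.mul hg1)
    have a := integral_pd (μ := volume) hC ((hgc.mul_left (f := g)).mul_left (f := fun x => sL x)) e111
    rw [pd_mul (g := fun x => g x * g x) hsd (hgd.mul hgd), pd_mul hgd hgd, pd_sL, sL_e111] at a
    have hs : Continuous (fun x => sL x * g x) := sL.continuous.mul hgcont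
    have i1 : Integrable (fun x => 3 * (g x * g x)) := (int2 _ hgcont).const_mul _
    have i2 : Integrable (fun x => 2 * ((sL x * g x) * h x)) := (int1 _ hs).const_mul _
    have e : ∀ x, 3 * (g x * g x) + sL x * (pd e111 g x * g x + g x * pd e111 g x)
      = 3 * (g x * g x) + 2 * ((sL x * g x) * h x) := by intro x; rw [hh]; ring
    simp only [e] at a
    have p : 0 ≤ ∫ x, (3 * (g x * g x) + 2 * ((sL x * g x) * h x) - 2 * (g x * g x)
        + (9 * R ^ 2) * (h x * h x)) := by
      apply integral_nonneg; intro x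
      simp only [Pi.zero_apply]
      by_cases hx : g x = 0
      · simp only [hx]; nlinarith [mul_self_nonneg (h x), sq_nonneg (R * h x)]
      · have h3 : |sL x| ≤ 3 * R := (abs_sL_le x).trans (by linarith [hgs x hx])
        have h4 : (sL x) ^ 2 ≤ 9 * R ^ 2 := by
          rw [← sq_abs]; nlinarith [abs_nonneg (sL x)]
        nlinarith [sq_nonneg (g x + sL x * h x), mul_le_mul_of_nonneg_right h4 (sq_nonneg (h x))]
    have i3 : Integrable (fun x => 3 * (g x * g x) + 2 * ((sL x * g x) * h x)) := i1.add i2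
    have i4 : Integrable (fun x => 3 * (g x * g x) + 2 * ((sL x * g x) * h x) - 2 * (g x * g x)) :=
      i3.sub ((int2 _ hgcont).const_mul _)
    rw [integral_add i4 ((int1 _ hhcont).const_mul _),
      integral_sub i3 ((int2 _ hgcont).const_mul _), a, integral_const_mul,
      integral_const_mul] at p
    linarith
  have e1 : ∫ x, (g x) ^ 2 = ∫ x, g x * g x := by congr 1; ext x; ring
  have e2 : ∫ x, (w x) ^ 2 = ∫ x, w x * w x := by congr 1; ext x; ring
  rw [e1, e2, div_mul_eq_mul_div, le_div_iff₀ (by positivity)]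
  have : 0 ≤ ∫ x, w x * w x := integral_nonneg fun x => mul_self_nonneg _
  have h8 : R ^ 2 * (4 * τ ^ 2 * ∫ x, h x * h x) ≤ R ^ 2 * ∫ x, w x * w x :=
    mul_le_mul_of_nonneg_left z4 (sq_nonneg _)
  nlinarith [mul_le_mul_of_nonneg_left z5 (sq_nonneg τ), mul_nonneg (sq_nonneg R) this]

theorem lap_support {v : EuclideanSpace ℝ (Fin 3) → ℂ} (hc : HasCompactSupport v) :
    HasCompactSupport (lap v) := by
  have : ∀ i : Fin 3, HasCompactSupport (pd (ei i) (pd (ei i) v)) :=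
    fun i => pd_support (pd_support hc _) _
  have e : lap v = fun x => pd (ei 0) (pd (ei 0) v) x + pd (ei 1) (pd (ei 1) v) x +
    pd (ei 2) (pd (ei 2) v) x := by ext x; simp [lap, Fin.sum_univ_three]
  rw [e]; exact ((this 0).add (this 1)).add (this 2)

theorem lap_clm {v : EuclideanSpace ℝ (Fin 3) → ℂ} (hv : ContDiff ℝ 2 v) (L : ℂ →L[ℝ] ℝ) :
    lap (fun x => L (v x)) = fun x => L (lap v x) := by
  ext x
  simp only [lap, map_sum]
  refine Finset.sum_congr rfl fun i _ => ?_
  rw [pd_clm (hv.differentiable (by norm_num)), 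
    pd_clm ((pd_contDiff_one hv _).differentiable (by norm_num))]

theorem carleman (R τ : ℝ) (hR : 0 ≤ R) (hτ : 0 < τ) (v : EuclideanSpace ℝ (Fin 3) → ℂ)
    (hv : ContDiff ℝ 2 v) (hc : HasCompactSupport v) (hsupp : ∀ x, v x ≠ 0 → ‖x‖ ≤ R) :
    ∫ x, (Real.exp (-τ * sL x) * ‖v x‖) ^ 2 ≤
      (2 * R ^ 2 / τ ^ 2) * ∫ x, (Real.exp (-τ * sL x) * ‖lap v x‖) ^ 2 := by
  have hsplit : ∀ (e : ℝ) (z : ℂ), (e * ‖z‖) ^ 2 = (e * Complex.reCLM z) ^ 2 + (e * Complex.imCLM z) ^ 2 := by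
    intro e z
    rw [mul_pow, ← Complex.normSq_eq_norm_sq, Complex.normSq_apply]
    simp; ring
  have hE : Continuous (fun x => Real.exp (-τ * sL x)) := (exp_contDiff (-τ) (n := 1)).continuous
  have int : ∀ (f : EuclideanSpace ℝ (Fin 3) → ℂ) (L : ℂ →L[ℝ] ℝ), Continuous f → HasCompactSupport f →
      Integrable (fun x => (Real.exp (-τ * sL x) * L (f x)) ^ 2) := by
    intro f L hf hfc
    have h1 : HasCompactSupport (fun x => L (f x)) := hfc.comp_left (g := L) (map_zero L)
    have h2 : Continuous (fun x => (Real.exp (-τ * sL x) * L (f x))) := hE.mul (L.continuous.comp hf)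
    have h3 : HasCompactSupport (fun x => (Real.exp (-τ * sL x) * L (f x))) := h1.mul_left
    simp only [pow_two]
    exact (h2.mul h2).integrable_of_hasCompactSupport h3.mul_left
  have key : ∀ L : ℂ →L[ℝ] ℝ, ∫ x, (Real.exp (-τ * sL x) * L (v x)) ^ 2 ≤
      (2 * R ^ 2 / τ ^ 2) * ∫ x, (Real.exp (-τ * sL x) * L (lap v x)) ^ 2 := by
    intro L
    have := carleman_real R τ hR hτ (fun x => L (v x)) (L.contDiff.comp hv)
      (hc.comp_left (g := L) (map_zero L)) (fun x hx => hsupp x (by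
        intro h0; apply hx; simp [h0]))
    rwa [lap_clm hv] at this
  simp only [hsplit]
  rw [integral_add (int _ _ hv.continuous hc) (int _ _ hv.continuous hc),
    integral_add (int _ _ (lap_continuous hv) (lap_support hc))
      (int _ _ (lap_continuous hv) (lap_support hc)), mul_add]
  exact add_le_add (key _) (key _)

theorem octant_closed : IsClosed octant := by
  have : octant = ⋂ i : Fin 3, {x : EuclideanSpace ℝ (Fin 3) | 0 ≤ x i} := by
    ext x; simp [octant]
  rw [this]
  exact isClosed_iInter fun i => isClosed_le continuous_const (by fun_prop)

theorem octant_meas : MeasurableSet octant := octant_closed.measurableSet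

theorem sL_nonneg {x : EuclideanSpace ℝ (Fin 3)} (hx : x ∈ octant) : 0 ≤ sL x := by
  rw [sL_apply]; exact Finset.sum_nonneg fun i _ => hx i

open scoped Pointwise in
theorem octant_smul {τ : ℝ} (hτ : 0 < τ) : τ • octant = octant := by
  ext x
  rw [Set.mem_smul_set_iff_inv_smul_mem₀ hτ.ne']
  simp only [octant, mem_setOf_eq, PiLp.smul_apply, smul_eq_mul]
  refine forall_congr' fun i => ?_
  constructor
  · intro h; have := mul_nonneg hτ.le h; rwa [mul_inv_cancel_left₀ hτ.ne'] at this
  · intro h; positivity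

theorem integral_octant_smul {F : Type*} [NormedAddCommGroup F] [NormedSpace ℝ F]
    (f : EuclideanSpace ℝ (Fin 3) → F) {τ : ℝ} (hτ : 0 < τ) :
    ∫ x in octant, f (τ • x) = (τ ^ 3)⁻¹ • ∫ x in octant, f x := by
  have := Measure.setIntegral_comp_smul_of_pos volume f octant hτ
  rw [octant_smul hτ] at this
  simpa using this

/-- integration over the octant is integration of a function over the pi-space -/
theorem integrableOn_octant_prod {f : Fin 3 → ℝ → ℂ} (hf : ∀ i, IntegrableOn (f i) (Ici 0)) :
    IntegrableOn (fun x : EuclideanSpace ℝ (Fin 3) => ∏ i, f i (x i)) octant := by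
  have h1 : Integrable (fun x : Fin 3 → ℝ => ∏ i, (Ici (0:ℝ)).indicator (f i) (x i)) :=
    Integrable.fintype_prod fun i => (integrable_indicator_iff measurableSet_Ici).2 (hf i)
  have h2 := (EuclideanSpace.volume_preserving_symm_measurableEquiv_toLp (Fin 3)).symm.integrable_comp_emb
    (MeasurableEquiv.measurableEmbedding _) (g := fun x : EuclideanSpace ℝ (Fin 3) => ∏ i, (Ici (0:ℝ)).indicator (f i) (x i))
  rw [← integrable_indicator_iff octant_meas]
  have h3 : octant.indicator (fun x : EuclideanSpace ℝ (Fin 3) => ∏ i, f i (x i)) =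
    fun x : EuclideanSpace ℝ (Fin 3) => ∏ i, (Ici (0:ℝ)).indicator (f i) (x i) := by
    ext x
    by_cases hx : x ∈ octant
    · rw [indicator_of_mem hx]
      exact Finset.prod_congr rfl fun i _ => (indicator_of_mem (hx i) _).symm
    · rw [indicator_of_notMem hx]
      simp only [octant, mem_setOf_eq, not_forall] at hx
      obtain ⟨i, hi⟩ := hx
      exact (Finset.prod_eq_zero (Finset.mem_univ i) (indicator_of_notMem hi _)).symm
  rw [h3]
  refine h2.1 ?_
  exact h1

theorem integral_octant_prod (f : Fin 3 → ℝ → ℂ) :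
    ∫ x in octant, ∏ i, f i (x i) = ∏ i, ∫ t in Ici (0:ℝ), f i t := by
  have h3 : octant.indicator (fun x : EuclideanSpace ℝ (Fin 3) => ∏ i, f i (x i)) =
    fun x : EuclideanSpace ℝ (Fin 3) => ∏ i, (Ici (0:ℝ)).indicator (f i) (x i) := by
    ext x
    by_cases hx : x ∈ octant
    · rw [indicator_of_mem hx]
      exact Finset.prod_congr rfl fun i _ => (indicator_of_mem (hx i) _).symm
    · rw [indicator_of_notMem hx]
      simp only [octant, mem_setOf_eq, not_forall] at hx
      obtain ⟨i, hi⟩ := hx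
      exact (Finset.prod_eq_zero (Finset.mem_univ i) (indicator_of_notMem hi _)).symm
  rw [← integral_indicator octant_meas, h3]
  have h2 := (EuclideanSpace.volume_preserving_symm_measurableEquiv_toLp (Fin 3)).symm.integral_comp
    (MeasurableEquiv.measurableEmbedding _) (fun x : EuclideanSpace ℝ (Fin 3) => ∏ i, (Ici (0:ℝ)).indicator (f i) (x i))
  rw [← h2]
  have h4 := integral_fintype_prod_volume_eq_prod (fun i => (Ici (0:ℝ)).indicator (f i))
  simp only [integral_indicator measurableSet_Ici] at h4
  rw [← h4]
  rfl

theorem integrableOn_exp (a : ℝ) (ha : 0 < a) :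
    IntegrableOn (fun x : EuclideanSpace ℝ (Fin 3) => Real.exp (-a * sL x)) octant := by
  have h := integrableOn_octant_prod (f := fun _ t => ((Real.exp (-a * t) : ℝ) : ℂ)) (fun i => by
    have : IntegrableOn (fun t => Real.exp (-a * t)) (Ici 0) := by
      rw [integrableOn_Ici_iff_integrableOn_Ioi]
      exact integrableOn_exp_mul_Ioi (by linarith) 0
    exact this.ofReal)
  have h2 := h.re
  refine h2.congr (Filter.Eventually.of_forall fun x => ?_)
  simp only [← Complex.ofReal_prod, ← Real.exp_sum, ← Finset.mul_sum, ← sL_apply]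
  exact Complex.ofReal_re _

theorem integrableOn_pow_exp (m : ℕ) (a : ℝ) (ha : 0 < a) :
    IntegrableOn (fun x : EuclideanSpace ℝ (Fin 3) => (sL x) ^ m * Real.exp (-a * sL x)) octant := by
  have hb : ∀ s : ℝ, 0 ≤ s → s ^ m * Real.exp (-a * s) ≤
      (m.factorial * (2 / a) ^ m) * Real.exp (-(a/2) * s) := by
    intro s hs
    have h1 := Real.pow_div_factorial_le_exp (a / 2 * s) (by positivity) m
    rw [div_le_iff₀ (by positivity)] at h1
    have h2 : s ^ m = (2 / a) ^ m * (a / 2 * s) ^ m := by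
      rw [← mul_pow]; congr 1; field_simp
    have h3 : Real.exp (-a * s) = Real.exp (-(a/2) * s) * Real.exp (-(a / 2 * s)) := by
      rw [← Real.exp_add]; congr 1; ring
    have h4 : Real.exp (a / 2 * s) * Real.exp (-(a / 2 * s)) = 1 := by
      rw [← Real.exp_add]; simp
    rw [h2, h3]
    have e1 : 0 ≤ (2 / a) ^ m * Real.exp (-(a/2) * s) * Real.exp (-(a / 2 * s)) := by positivity
    calc (2 / a) ^ m * (a / 2 * s) ^ m * (Real.exp (-(a/2) * s) * Real.exp (-(a / 2 * s)))
        = ((2 / a) ^ m * Real.exp (-(a/2) * s) * Real.exp (-(a / 2 * s))) * (a / 2 * s) ^ m := by ring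
      _ ≤ ((2 / a) ^ m * Real.exp (-(a/2) * s) * Real.exp (-(a / 2 * s))) * (Real.exp (a / 2 * s) * m.factorial) :=
          mul_le_mul_of_nonneg_left h1 e1
      _ = ((2 / a) ^ m * Real.exp (-(a/2) * s) * m.factorial) * (Real.exp (a / 2 * s) * Real.exp (-(a / 2 * s))) := by ring
      _ = _ := by rw [h4]; ring
  refine Integrable.mono' ((integrableOn_exp (a/2) (by positivity)).const_mul (m.factorial * (2 / a) ^ m)) ?_ ?_
  · exact Continuous.aestronglyMeasurable (by fun_prop)
  · refine (ae_restrict_iff' octant_meas).2 (Filter.Eventually.of_forall fun x hx => ?_)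
    have := sL_nonneg hx
    rw [Real.norm_of_nonneg (by positivity)]
    exact hb _ this

/-- moment constants -/
noncomputable def Jm (m : ℕ) : ℝ := ∫ x in octant, (sL x) ^ m * Real.exp (-1 * sL x)

theorem Jm_nonneg (m : ℕ) : 0 ≤ Jm m :=
  setIntegral_nonneg octant_meas fun x hx => by have := sL_nonneg hx; positivity

theorem integral_pow_exp (m : ℕ) (τ : ℝ) (hτ : 0 < τ) :
    ∫ x in octant, (sL x) ^ m * Real.exp (-τ * sL x) = (τ ^ (m + 3))⁻¹ * Jm m := by
  have := integral_octant_smul (fun x => (sL x) ^ m * Real.exp (-1 * sL x)) hτ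
  simp only [map_smul, smul_eq_mul] at this
  have e : ∀ x : EuclideanSpace ℝ (Fin 3), (τ * sL x) ^ m * Real.exp (-1 * (τ * sL x)) =
      τ ^ m * ((sL x) ^ m * Real.exp (-τ * sL x)) := by
    intro x; rw [mul_pow, mul_assoc]; congr 3; ring
  simp only [e, integral_const_mul] at this
  rw [Jm, pow_add, mul_inv, mul_assoc, ← this]
  field_simp

/-- complex exponential -/
noncomputable def cE (c : Fin 3 → ℂ) (x : EuclideanSpace ℝ (Fin 3)) : ℂ :=
  Complex.exp (∑ i, c i * (x i : ℂ))

theorem cE_contDiff (c : Fin 3 → ℂ) {n : WithTop ℕ∞} : ContDiff ℝ n (cE c) := by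
  unfold cE
  refine ContDiff.cexp (ContDiff.sum fun i _ => contDiff_const.mul ?_)
  exact Complex.ofRealCLM.contDiff.comp (EuclideanSpace.proj (𝕜 := ℝ) i).contDiff

theorem pd_cE (c : Fin 3 → ℂ) (j : Fin 3) : pd (ei j) (cE c) = fun x => c j * cE c x := by
  ext x
  have h : HasFDerivAt (fun x : EuclideanSpace ℝ (Fin 3) => ∑ i, c i * (x i : ℂ))
      (∑ i, c i • (Complex.ofRealCLM.comp (EuclideanSpace.proj (𝕜 := ℝ) i))) x := by
    refine HasFDerivAt.fun_sum fun i _ => ?_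
    exact ((Complex.ofRealCLM.comp (EuclideanSpace.proj (𝕜 := ℝ) i)).hasFDerivAt (x := x)).const_mul (c i)
  have h2 := h.cexp.fderiv
  change fderiv ℝ (fun x : EuclideanSpace ℝ (Fin 3) => Complex.exp (∑ i, c i * (x i : ℂ))) x _ = _
  rw [h2]
  have h3 : ∀ y : Fin 3, c y * ((if y = j then (1:ℝ) else 0 : ℝ) : ℂ) = if y = j then c y else 0 := by
    intro y; split_ifs <;> simp
  simp [cE, sum_apply, Pi.single_apply]
  simp only [h3, Finset.sum_ite_eq', Finset.mem_univ, if_true]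
  ring

theorem lap_cE (c : Fin 3 → ℂ) : lap (cE c) = fun x => (∑ i, c i ^ 2) * cE c x := by
  ext x
  simp only [lap, Finset.sum_mul]
  refine Finset.sum_congr rfl fun i _ => ?_
  rw [pd_cE, pd_const_mul ((cE_contDiff c (n := 1)).differentiable (by norm_num)), pd_cE]
  ring

theorem norm_cE_le {σ : ℝ} (hσ : 0 < σ) {ρ : Fin 3 → ℂ} (hρ : ∀ i, 2 ≤ (ρ i).re)
    {x : EuclideanSpace ℝ (Fin 3)} (hx : x ∈ octant) :
    ‖cE (fun i => -(σ * ρ i)) x‖ ≤ Real.exp (-(2 * σ) * sL x) := by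
  rw [cE, Complex.norm_exp, Real.exp_le_exp, sL_apply, Complex.re_sum, Finset.mul_sum]
  refine Finset.sum_le_sum fun i _ => ?_
  have := hx i
  have h : (-(↑σ * ρ i) * (x i : ℂ)).re = -(σ * (ρ i).re * x i) := by
    simp
  rw [h]
  have : 2 * (σ * x i) ≤ (ρ i).re * (σ * x i) := mul_le_mul_of_nonneg_right (hρ i) (by positivity)
  nlinarith

theorem lap_zero_off {v : EuclideanSpace ℝ (Fin 3) → ℂ} (hoff : ∀ x, x ∉ octant → v x = 0) :
    ∀ x, x ∉ octant → lap v x = 0 := by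
  have step : ∀ (f : EuclideanSpace ℝ (Fin 3) → ℂ) (w : EuclideanSpace ℝ (Fin 3)),
      (∀ x, x ∉ octant → f x = 0) → ∀ x, x ∉ octant → pd w f x = 0 := by
    intro f w hf x hx
    have : f =ᶠ[nhds x] fun _ => 0 := by
      filter_upwards [octant_closed.isOpen_compl.mem_nhds hx] with y hy using hf y hy
    simp only [pd]
    rw [this.fderiv_eq]; simp
  intro x hx
  simp only [lap]
  exact Finset.sum_eq_zero fun i _ => step _ _ (step _ _ hoff) x hx

theorem carleman_decay (N : ℕ) (R A B1 B2 : ℝ) (hR : 0 ≤ R)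
    (v : EuclideanSpace ℝ (Fin 3) → ℂ)
    (hv : ContDiff ℝ 2 v) (hc : HasCompactSupport v) (hsupp : ∀ x, v x ≠ 0 → ‖x‖ ≤ R)
    (hoff : ∀ x, x ∉ octant → v x = 0)
    (hb : ∀ x ∈ octant, ‖lap v x‖ ≤ A * ‖v x‖ + B1 * (sL x) ^ N + B2 * (sL x) ^ (N + 1)) :
    ∃ K : ℝ, 0 ≤ K ∧ ∃ σ₀ : ℝ, 1 ≤ σ₀ ∧ ∀ σ ≥ σ₀,
      ∫ x, (Real.exp (-σ * sL x) * ‖v x‖) ^ 2 ≤ K * (σ ^ (2 * N + 5))⁻¹ := by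
  refine ⟨12 * R ^ 2 * (B1 ^ 2 * Jm (2 * N) + B2 ^ 2 * Jm (2 * (N + 1))), ?_, 1 + 12 * R ^ 2 * A ^ 2, ?_, ?_⟩
  · have := Jm_nonneg (2 * N); have := Jm_nonneg (2 * (N + 1)); positivity
  · nlinarith [mul_nonneg (sq_nonneg R) (sq_nonneg A)]
  intro σ hσ
  have hσ1 : 1 ≤ σ := le_trans (by nlinarith [mul_nonneg (sq_nonneg R) (sq_nonneg A)]) hσ
  have hσ0 : 0 < σ := by linarith
  have hcar := carleman R σ hR hσ0 v hv hc hsupp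
  set Y := ∫ x, (Real.exp (-σ * sL x) * ‖v x‖) ^ 2 with hY
  have hY0 : 0 ≤ Y := integral_nonneg fun x => sq_nonneg _
  have hE : Continuous (fun x => Real.exp (-σ * sL x)) := (exp_contDiff (-σ) (n := 1)).continuous
  have hYint : Integrable (fun x => (Real.exp (-σ * sL x) * ‖v x‖) ^ 2) := by
    simp only [pow_two]
    have h2 : Continuous (fun x => (Real.exp (-σ * sL x) * ‖v x‖)) := hE.mul hv.continuous.norm
    have h3 : HasCompactSupport (fun x => (Real.exp (-σ * sL x) * ‖v x‖)) := hc.norm.mul_left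
    exact (h2.mul h2).integrable_of_hasCompactSupport h3.mul_left
  have hle : ∫ x, (Real.exp (-σ * sL x) * ‖lap v x‖) ^ 2 ≤
      3 * (A ^ 2 * Y + B1 ^ 2 * (((2*σ) ^ (2 * N + 3))⁻¹ * Jm (2 * N)) +
        B2 ^ 2 * (((2*σ) ^ (2 * (N+1) + 3))⁻¹ * Jm (2 * (N+1)))) := by
    rw [← integral_pow_exp _ _ (by positivity), ← integral_pow_exp _ _ (by positivity)]
    have e : ∫ x, (Real.exp (-σ * sL x) * ‖lap v x‖) ^ 2 =
        ∫ x in octant, (Real.exp (-σ * sL x) * ‖lap v x‖) ^ 2 := by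
      symm; apply setIntegral_eq_integral_of_forall_compl_eq_zero
      intro x hx; rw [lap_zero_off hoff x hx]; simp
    have hY' : ∫ x in octant, (Real.exp (-σ * sL x) * ‖v x‖) ^ 2 ≤ Y := 
      setIntegral_le_integral hYint (Filter.Eventually.of_forall fun x => sq_nonneg _)
    rw [e]
    have i1 := hYint.integrableOn (s := octant)
    have i2 := integrableOn_pow_exp (2 * N) (2 * σ) (by positivity)
    have i3 := integrableOn_pow_exp (2 * (N + 1)) (2 * σ) (by positivity)
    have i12 : IntegrableOn (fun x => A ^ 2 * (Real.exp (-σ * sL x) * ‖v x‖) ^ 2 +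
        B1 ^ 2 * ((sL x) ^ (2 * N) * Real.exp (-(2 * σ) * sL x))) octant :=
      (i1.const_mul _).add (i2.const_mul _)
    have i123 : IntegrableOn (fun x => A ^ 2 * (Real.exp (-σ * sL x) * ‖v x‖) ^ 2 +
        B1 ^ 2 * ((sL x) ^ (2 * N) * Real.exp (-(2 * σ) * sL x)) +
        B2 ^ 2 * ((sL x) ^ (2 * (N + 1)) * Real.exp (-(2 * σ) * sL x))) octant :=
      i12.add (i3.const_mul _)
    calc ∫ x in octant, (Real.exp (-σ * sL x) * ‖lap v x‖) ^ 2
        ≤ ∫ x in octant, 3 * (A ^ 2 * (Real.exp (-σ * sL x) * ‖v x‖) ^ 2 +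
        B1 ^ 2 * ((sL x) ^ (2 * N) * Real.exp (-(2 * σ) * sL x)) +
        B2 ^ 2 * ((sL x) ^ (2 * (N + 1)) * Real.exp (-(2 * σ) * sL x))) := by
          refine integral_mono_of_nonneg (Filter.Eventually.of_forall fun x => sq_nonneg _)
            (i123.const_mul 3) ?_
          refine (ae_restrict_iff' octant_meas).2 (Filter.Eventually.of_forall fun x hx => ?_)
          have h1 := hb x hx
          have h2 : Real.exp (-(2 * σ) * sL x) = Real.exp (-σ * sL x) * Real.exp (-σ * sL x) := by
            rw [← Real.exp_add]; congr 1; ring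
          simp only [h2, pow_mul']
          set e := Real.exp (-σ * sL x)
          set a := A * ‖v x‖
          set b := B1 * (sL x) ^ N
          set d := B2 * (sL x) ^ (N + 1)
          have h3 : ‖lap v x‖ ^ 2 ≤ (a + b + d) ^ 2 := pow_le_pow_left₀ (norm_nonneg _) h1 2
          have h4 : (a + b + d) ^ 2 ≤ 3 * (a ^ 2 + b ^ 2 + d ^ 2) := by
            nlinarith [sq_nonneg (a - b), sq_nonneg (b - d), sq_nonneg (a - d)]
          calc (e * ‖lap v x‖) ^ 2 = e ^ 2 * ‖lap v x‖ ^ 2 := by ring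
            _ ≤ e ^ 2 * (3 * (a ^ 2 + b ^ 2 + d ^ 2)) :=
                mul_le_mul_of_nonneg_left (h3.trans h4) (sq_nonneg _)
            _ = _ := by simp only [a, b, d]; ring
      _ ≤ _ := by
          rw [integral_const_mul, integral_add i12 (i3.const_mul _),
            integral_add (i1.const_mul _) (i2.const_mul _), integral_const_mul, integral_const_mul,
            integral_const_mul]
          have := mul_le_mul_of_nonneg_left hY' (sq_nonneg A)
          linarith
  have hJ1 := Jm_nonneg (2 * N)
  have hJ2 := Jm_nonneg (2 * (N + 1))
  set X := (σ ^ (2 * N + 3))⁻¹ with hX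
  have hX0 : 0 ≤ X := by positivity
  have x1 : ((2*σ) ^ (2 * N + 3))⁻¹ ≤ X := by
    apply inv_anti₀ (by positivity)
    exact pow_le_pow_left₀ hσ0.le (by linarith) _
  have x2 : ((2*σ) ^ (2 * (N+1) + 3))⁻¹ ≤ X := by
    apply inv_anti₀ (by positivity)
    calc σ ^ (2 * N + 3) ≤ σ ^ (2 * (N+1) + 3) := pow_le_pow_right₀ hσ1 (by omega)
      _ ≤ _ := pow_le_pow_left₀ hσ0.le (by linarith) _
  have hXe : (σ ^ (2 * N + 5))⁻¹ = X / σ ^ 2 := by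
    rw [hX, div_eq_mul_inv, ← mul_inv, ← pow_add]
  set T := B1 ^ 2 * Jm (2 * N) + B2 ^ 2 * Jm (2 * (N + 1)) with hT
  have hle2 : ∫ x, (Real.exp (-σ * sL x) * ‖lap v x‖) ^ 2 ≤ 3 * (A ^ 2 * Y + X * T) := by
    refine hle.trans ?_
    have y1 := mul_le_mul_of_nonneg_left (mul_le_mul_of_nonneg_right x1 hJ1) (sq_nonneg B1)
    have y2 := mul_le_mul_of_nonneg_left (mul_le_mul_of_nonneg_right x2 hJ2) (sq_nonneg B2)
    rw [hT]; linarith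
  have h1 : Y ≤ (2 * R ^ 2 / σ ^ 2) * (3 * (A ^ 2 * Y + X * T)) :=
    hcar.trans (mul_le_mul_of_nonneg_left hle2 (by positivity))
  rw [div_mul_eq_mul_div, le_div_iff₀ (by positivity)] at h1
  rw [hXe, mul_div_assoc', le_div_iff₀ (by positivity)]
  have h2 : 12 * R ^ 2 * A ^ 2 ≤ σ ^ 2 := by nlinarith
  have h3 := mul_le_mul_of_nonneg_right h2 hY0
  nlinarith

theorem laplace_vanish (N : ℕ) (R A κ' : ℝ) (κ : ℂ) (hR : 0 ≤ R) (hA : 0 ≤ A)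
    (v P : EuclideanSpace ℝ (Fin 3) → ℂ)
    (hv : ContDiff ℝ 2 v) (hc : HasCompactSupport v) (hsupp : ∀ x, v x ≠ 0 → ‖x‖ ≤ R)
    (hoff : ∀ x, x ∉ octant → v x = 0)
    (hP : Continuous P) (hPb : ∀ x ∈ octant, ‖P x‖ ≤ κ' * (sL x) ^ N)
    (hPh : ∀ (τ : ℝ) x, P (τ • x) = (τ:ℂ) ^ N * P x)
    (hb : ∀ ε > (0:ℝ), ∃ B : ℝ, ∀ x ∈ octant,
      ‖lap v x - κ * P x‖ ≤ A * ‖v x‖ + ε * (sL x) ^ N + B * (sL x) ^ (N + 1))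
    (ρ : Fin 3 → ℂ) (hρ : ∀ i, 2 ≤ (ρ i).re) (hnull : ∑ i, ρ i ^ 2 = 0) :
    κ * ∫ x in octant, P x * cE (fun i => - ρ i) x = 0 := by
  obtain ⟨Bz, hBz⟩ := hb 1 one_pos
  obtain ⟨K, hK, σ₀, hσ₀, hdec⟩ := carleman_decay N R A (1 + ‖κ‖ * κ') Bz hR v hv hc hsupp hoff (by
    intro x hx
    have h1 := hBz x hx
    have h2 := mul_le_mul_of_nonneg_left (hPb x hx) (norm_nonneg κ)
    have h3 : ‖lap v x‖ ≤ ‖lap v x - κ * P x‖ + ‖κ * P x‖ := by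
      simpa using norm_add_le (lap v x - κ * P x) (κ * P x)
    rw [norm_mul] at h3
    linarith)
  set I := ∫ x in octant, P x * cE (fun i => - ρ i) x with hI
  have hscale : ∀ σ : ℝ, 0 < σ →
      ∫ x in octant, P x * cE (fun i => -(σ * ρ i)) x = ((σ ^ (N + 3) : ℝ) : ℂ)⁻¹ * I := by
    intro σ hσ
    have := integral_octant_smul (fun x => P x * cE (fun i => - ρ i) x) hσ
    simp only [hPh] at this
    have e : ∀ x : EuclideanSpace ℝ (Fin 3), (σ:ℂ) ^ N * P x * cE (fun i => - ρ i) (σ • x) =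
        (σ:ℂ) ^ N * (P x * cE (fun i => -(σ * ρ i)) x) := by
      intro x
      rw [mul_assoc]; congr 2
      simp only [cE]; congr 1
      refine Finset.sum_congr rfl fun i _ => ?_
      simp; ring
    simp only [e, integral_const_mul] at this
    have hσc : (σ:ℂ) ≠ 0 := by exact_mod_cast hσ.ne'
    rw [← hI, Complex.real_smul] at this
    push_cast at this ⊢
    rw [pow_add, mul_inv, mul_assoc, ← this]
    field_simp
  have main : ∀ ε > (0:ℝ), ∃ B : ℝ, ∀ σ ≥ σ₀, ‖κ * I‖ ≤ ε * Jm N + B / σ := by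
    intro ε hε
    obtain ⟨B, hB⟩ := hb ε hε
    refine ⟨A * (K + Jm 0) + |B| * Jm (N + 1), fun σ hσ => ?_⟩
    have hσ1 : 1 ≤ σ := hσ₀.trans hσ
    have hσ0 : 0 < σ := by linarith
    have hd := hdec σ hσ
    set c : Fin 3 → ℂ := fun i => -(σ * ρ i) with hcdef
    have hcc : Continuous (cE c) := (cE_contDiff c (n := 0)).continuous
    have hlc := lap_continuous hv
    -- the orthogonality
    have orth : ∫ x in octant, lap v x * cE c x = 0 := by
      rw [setIntegral_eq_integral_of_forall_compl_eq_zero]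
      · have h := integral_lap_mul (cE_contDiff c) hv hc
        rw [lap_cE] at h
        have h0 : ∑ i, c i ^ 2 = 0 := by
          have : ∀ i, c i ^ 2 = (σ:ℂ) ^ 2 * ρ i ^ 2 := by intro i; simp only [hcdef]; ring
          simp only [this, ← Finset.mul_sum, hnull, mul_zero]
        simp only [h0, zero_mul, integral_zero] at h
        rw [← h]; congr 1; ext x; ring
      · intro x hx; rw [lap_zero_off hoff x hx, zero_mul]
    have il : IntegrableOn (fun x => lap v x * cE c x) octant :=
      ((hlc.mul hcc).integrable_of_hasCompactSupport (lap_support hc).mul_right).integrableOn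
    have iP : IntegrableOn (fun x => P x * cE c x) octant := by
      refine Integrable.mono' ((integrableOn_pow_exp N (2 * σ) (by positivity)).const_mul κ')
        (hP.mul hcc).aestronglyMeasurable ?_
      refine (ae_restrict_iff' octant_meas).2 (Filter.Eventually.of_forall fun x hx => ?_)
      rw [norm_mul, ← mul_assoc]
      exact mul_le_mul (hPb x hx) (norm_cE_le hσ0 hρ hx) (norm_nonneg _)
        ((norm_nonneg _).trans (hPb x hx))
    have e1 : κ * (((σ ^ (N + 3) : ℝ) : ℂ)⁻¹ * I) =
        - ∫ x in octant, (lap v x - κ * P x) * cE c x := by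
      have : ∀ x, (lap v x - κ * P x) * cE c x = lap v x * cE c x - κ * (P x * cE c x) := by
        intro x; ring
      simp only [this]
      rw [integral_sub il (iP.const_mul κ), orth, integral_const_mul, hscale σ hσ0]
      ring
    have hE : Continuous (fun x => Real.exp (-σ * sL x)) := (exp_contDiff (-σ) (n := 1)).continuous
    have hYint : Integrable (fun x => (Real.exp (-σ * sL x) * ‖v x‖) ^ 2) := by
      simp only [pow_two]
      have h2 : Continuous (fun x => (Real.exp (-σ * sL x) * ‖v x‖)) := hE.mul hv.continuous.norm
      have h3 : HasCompactSupport (fun x => (Real.exp (-σ * sL x) * ‖v x‖)) := hc.norm.mul_left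
      exact (h2.mul h2).integrable_of_hasCompactSupport h3.mul_left
    have i1 := hYint.integrableOn (s := octant)
    have i0 := integrableOn_pow_exp 0 (2 * σ) (by positivity)
    have i2 := integrableOn_pow_exp N (2 * σ) (by positivity)
    have i3 := integrableOn_pow_exp (N + 1) (2 * σ) (by positivity)
    have hY' : ∫ x in octant, (Real.exp (-σ * sL x) * ‖v x‖) ^ 2 ≤ K * (σ ^ (2 * N + 5))⁻¹ :=
      (setIntegral_le_integral hYint (Filter.Eventually.of_forall fun x => sq_nonneg _)).trans hd
    set S := σ ^ (N + 1) with hS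
    have hS0 : 0 < S := by positivity
    have j1 : IntegrableOn (fun x => A * (S * (Real.exp (-σ * sL x) * ‖v x‖) ^ 2) +
        A * (S⁻¹ * ((sL x) ^ 0 * Real.exp (-(2 * σ) * sL x)))) octant :=
      ((i1.const_mul _).const_mul _).add ((i0.const_mul _).const_mul _)
    have j2 : IntegrableOn (fun x => A * (S * (Real.exp (-σ * sL x) * ‖v x‖) ^ 2) +
        A * (S⁻¹ * ((sL x) ^ 0 * Real.exp (-(2 * σ) * sL x))) +
        ε * ((sL x) ^ N * Real.exp (-(2 * σ) * sL x))) octant := j1.add (i2.const_mul _)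
    have j3 : IntegrableOn (fun x => A * (S * (Real.exp (-σ * sL x) * ‖v x‖) ^ 2) +
        A * (S⁻¹ * ((sL x) ^ 0 * Real.exp (-(2 * σ) * sL x))) +
        ε * ((sL x) ^ N * Real.exp (-(2 * σ) * sL x)) +
        |B| * ((sL x) ^ (N + 1) * Real.exp (-(2 * σ) * sL x))) octant := j2.add (i3.const_mul _)
    have e2 : ‖∫ x in octant, (lap v x - κ * P x) * cE c x‖ ≤
        A * (S * (K * (σ ^ (2 * N + 5))⁻¹)) + A * (S⁻¹ * (((2 * σ) ^ (0 + 3))⁻¹ * Jm 0)) +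
        ε * (((2 * σ) ^ (N + 3))⁻¹ * Jm N) + |B| * (((2 * σ) ^ (N + 1 + 3))⁻¹ * Jm (N + 1)) := by
      calc ‖∫ x in octant, (lap v x - κ * P x) * cE c x‖
          ≤ ∫ x in octant, (A * (S * (Real.exp (-σ * sL x) * ‖v x‖) ^ 2) +
        A * (S⁻¹ * ((sL x) ^ 0 * Real.exp (-(2 * σ) * sL x))) +
        ε * ((sL x) ^ N * Real.exp (-(2 * σ) * sL x)) +
        |B| * ((sL x) ^ (N + 1) * Real.exp (-(2 * σ) * sL x))) := by
            refine norm_integral_le_of_norm_le j3 ?_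
            refine (ae_restrict_iff' octant_meas).2 (Filter.Eventually.of_forall fun x hx => ?_)
            have hs := sL_nonneg hx
            have h2 : Real.exp (-(2 * σ) * sL x) = Real.exp (-σ * sL x) * Real.exp (-σ * sL x) := by
              rw [← Real.exp_add]; congr 1; ring
            have h3 : ‖lap v x - κ * P x‖ ≤ A * ‖v x‖ + ε * (sL x) ^ N + |B| * (sL x) ^ (N + 1) :=
              (hB x hx).trans (by gcongr; exact le_abs_self B)
            rw [norm_mul]
            refine (mul_le_mul h3 (norm_cE_le hσ0 hρ hx) (norm_nonneg _)
              ((norm_nonneg _).trans h3)).trans ?_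
            set e := Real.exp (-σ * sL x)
            have h4 : ‖v x‖ * (e * e) ≤ S * (e * ‖v x‖) ^ 2 + S⁻¹ * (e * e) := by
              have hSi : S * S⁻¹ = 1 := mul_inv_cancel₀ hS0.ne'
              have hSi0 : 0 < S⁻¹ := by positivity
              have : 0 ≤ S⁻¹ * (S * (e * ‖v x‖) - e) ^ 2 := by positivity
              have h5 : S⁻¹ * (S * (e * ‖v x‖) - e) ^ 2 = (S * S⁻¹) * (S * (e * ‖v x‖) ^ 2)
                - 2 * (S * S⁻¹) * (‖v x‖ * (e * e)) + S⁻¹ * (e * e) := by ring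
              rw [h5, hSi] at this
              have : 0 ≤ S * (e * ‖v x‖) ^ 2 := by positivity
              have : 0 ≤ S⁻¹ * (e * e) := by positivity
              nlinarith
            have h6 := mul_le_mul_of_nonneg_left h4 hA
            rw [h2]
            nlinarith
        _ = A * (S * ∫ x in octant, (Real.exp (-σ * sL x) * ‖v x‖) ^ 2) +
            A * (S⁻¹ * (((2 * σ) ^ (0 + 3))⁻¹ * Jm 0)) +
        ε * (((2 * σ) ^ (N + 3))⁻¹ * Jm N) + |B| * (((2 * σ) ^ (N + 1 + 3))⁻¹ * Jm (N + 1)) := by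
            rw [integral_add j2 (i3.const_mul _), integral_add j1 (i2.const_mul _),
              integral_add ((i1.const_mul _).const_mul _) ((i0.const_mul _).const_mul _)]
            simp only [integral_const_mul]
            rw [integral_pow_exp _ _ (by positivity), integral_pow_exp _ _ (by positivity),
              integral_pow_exp _ _ (by positivity)]
        _ ≤ _ := by gcongr
    have e3 : ‖κ * I‖ = σ ^ (N + 3) * ‖∫ x in octant, (lap v x - κ * P x) * cE c x‖ := by
      rw [← norm_neg (∫ x in octant, (lap v x - κ * P x) * cE c x), ← e1]
      simp only [norm_mul, norm_inv, Complex.norm_real, Real.norm_of_nonneg (pow_nonneg hσ0.le (N+3))]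
      field_simp
    rw [e3]
    have hJ0 := Jm_nonneg 0
    have hJN := Jm_nonneg N
    have hJ1 := Jm_nonneg (N + 1)
    have q1 : ((2 * σ) ^ (0 + 3))⁻¹ ≤ (σ ^ (0 + 3))⁻¹ :=
      inv_anti₀ (by positivity) (pow_le_pow_left₀ hσ0.le (by linarith) _)
    have q2 : ((2 * σ) ^ (N + 3))⁻¹ ≤ (σ ^ (N + 3))⁻¹ :=
      inv_anti₀ (by positivity) (pow_le_pow_left₀ hσ0.le (by linarith) _)
    have q3 : ((2 * σ) ^ (N + 1 + 3))⁻¹ ≤ (σ ^ (N + 1 + 3))⁻¹ :=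
      inv_anti₀ (by positivity) (pow_le_pow_left₀ hσ0.le (by linarith) _)
    calc σ ^ (N + 3) * ‖∫ x in octant, (lap v x - κ * P x) * cE c x‖
        ≤ σ ^ (N + 3) * (A * (S * (K * (σ ^ (2 * N + 5))⁻¹)) + A * (S⁻¹ * ((σ ^ (0 + 3))⁻¹ * Jm 0)) +
        ε * ((σ ^ (N + 3))⁻¹ * Jm N) + |B| * ((σ ^ (N + 1 + 3))⁻¹ * Jm (N + 1))) := by
          refine mul_le_mul_of_nonneg_left (e2.trans ?_) (by positivity)
          gcongr
      _ = _ := by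
          rw [hS]
          field_simp
          ring
  -- conclude
  have h0 : ∀ ε > (0:ℝ), ‖κ * I‖ ≤ ε * Jm N := by
    intro ε hε
    obtain ⟨B, hB⟩ := main ε hε
    have ht : Filter.Tendsto (fun σ : ℝ => ε * Jm N + B / σ) Filter.atTop (nhds (ε * Jm N + 0)) :=
      tendsto_const_nhds.add (tendsto_const_nhds.div_atTop Filter.tendsto_id)
    rw [add_zero] at ht
    exact ge_of_tendsto ht ((Filter.eventually_ge_atTop σ₀).mono hB)
  have h1 : Filter.Tendsto (fun ε : ℝ => ε * Jm N) (nhdsWithin 0 (Ioi 0)) (nhds (0 * Jm N)) :=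
    ((continuous_id.mul continuous_const).tendsto 0).mono_left nhdsWithin_le_nhds
  rw [zero_mul] at h1
  have h2 : ‖κ * I‖ ≤ 0 := ge_of_tendsto h1 (by
    filter_upwards [self_mem_nhdsWithin] with ε hε using h0 ε hε)
  exact norm_le_zero_iff.1 h2

/-- the polynomial obtained after clearing denominators -/
noncomputable def clearF (c : ℕ → ℕ → ℕ → ℂ) (N M : ℕ) (x y z : ℂ) : ℂ :=
  ∑ a ∈ Finset.range (N+1), ∑ b ∈ Finset.range (N+1), ∑ d ∈ Finset.range (M+1),
    c a b d * x ^ (N - a) * y ^ (N - b) * z ^ (M - d)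

theorem clearF_zero (c : ℕ → ℕ → ℕ → ℂ) (N M : ℕ) (hM : M ≤ N)
    (hd : ∀ a b d, M < d → c a b d = 0)
    (hz : ∀ ρ : Fin 3 → ℂ, (∀ i, 2 ≤ (ρ i).re) → ∑ i, ρ i ^ 2 = 0 →
      ∑ a ∈ Finset.range (N+1), ∑ b ∈ Finset.range (N+1), ∑ d ∈ Finset.range (N+1),
        c a b d * (((ρ 0) ^ (a+1))⁻¹ * ((ρ 1) ^ (b+1))⁻¹ * ((ρ 2) ^ (d+1))⁻¹) = 0)
    (x y z : ℂ) (hx : 2 ≤ x.re) (hy : 2 ≤ y.re) (hzz : 2 ≤ z.re) (hn : x^2+y^2+z^2 = 0) :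
    clearF c N M x y z = 0 := by
  have h := hz ![x,y,z] (by intro i; fin_cases i <;> simpa) (by simpa [Fin.sum_univ_three] using hn)
  have nz : ∀ w : ℂ, 2 ≤ w.re → w ≠ 0 := by
    rintro w hw rfl; simp at hw; linarith
  have hx0 := nz x hx
  have hy0 := nz y hy
  have hz0 := nz z hzz
  have e : clearF c N M x y z = x^(N+1) * y^(N+1) * z^(M+1) *
      ∑ a ∈ Finset.range (N+1), ∑ b ∈ Finset.range (N+1), ∑ d ∈ Finset.range (N+1),
        c a b d * ((x ^ (a+1))⁻¹ * (y ^ (b+1))⁻¹ * (z ^ (d+1))⁻¹) := by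
    unfold clearF
    simp only [Finset.mul_sum]
    refine Finset.sum_congr rfl fun a ha => Finset.sum_congr rfl fun b hb => ?_
    have hs : Finset.range (M+1) ⊆ Finset.range (N+1) := Finset.range_mono (by omega)
    rw [← Finset.sum_subset hs]
    · refine Finset.sum_congr rfl fun d hd' => ?_
      simp only [Finset.mem_range] at ha hb hd'
      have p : ∀ (w : ℂ) (n m : ℕ), w ≠ 0 → m < n + 1 → w ^ (n - m) = w^(n+1) * (w^(m+1))⁻¹ := by
        intro w n m hw hm
        rw [eq_mul_inv_iff_mul_eq₀ (pow_ne_zero _ hw), ← pow_add]; congr 1; omega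
      rw [p x N a hx0 ha, p y N b hy0 hb, p z M d hz0 hd']; ring
    · intro d _ h2
      simp only [Finset.mem_range, not_lt] at h2
      rw [hd a b d (by omega)]; simp
  rw [e]
  simp at h
  simp [h]

theorem clearF_at (c : ℕ → ℕ → ℕ → ℂ) (N M : ℕ) (hM : M ≤ N)
    (hd : ∀ a b d, M < d → c a b d = 0)
    (hz : ∀ ρ : Fin 3 → ℂ, (∀ i, 2 ≤ (ρ i).re) → ∑ i, ρ i ^ 2 = 0 →
      ∑ a ∈ Finset.range (N+1), ∑ b ∈ Finset.range (N+1), ∑ d ∈ Finset.range (N+1),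
        c a b d * (((ρ 0) ^ (a+1))⁻¹ * ((ρ 1) ^ (b+1))⁻¹ * ((ρ 2) ^ (d+1))⁻¹) = 0)
    (l s t0 : ℂ) (hs : s^2 = -1) (h0 : 2 < (l * (1 - t0^2)).re)
    (h1 : 2 < (l * (s * (1 + t0^2))).re) (h2 : 2 < (l * (2 * t0)).re) :
    clearF c N M l (l * s) 0 = 0 := by
  set H : ℂ → ℂ := fun t => clearF c N M (l * (1 - t^2)) (l * (s * (1 + t^2))) (l * (2 * t)) with hH
  have hdiff : Differentiable ℂ H := by
    rw [hH]; unfold clearF; fun_prop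
  have han : AnalyticOnNhd ℂ H Set.univ := fun x _ => hdiff.analyticAt x
  have hev : H =ᶠ[nhds t0] (fun _ => 0) := by
    have e0 : ∀ᶠ t in nhds t0, 2 < (l * (1 - t^2)).re :=
      ContinuousAt.eventually_lt continuousAt_const (by fun_prop) h0
    have e1 : ∀ᶠ t in nhds t0, 2 < (l * (s * (1 + t^2))).re :=
      ContinuousAt.eventually_lt continuousAt_const (by fun_prop) h1
    have e2 : ∀ᶠ t in nhds t0, 2 < (l * (2 * t)).re :=
      ContinuousAt.eventually_lt continuousAt_const (by fun_prop) h2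
    filter_upwards [e0, e1, e2] with t a0 a1 a2
    exact clearF_zero c N M hM hd hz _ _ _ a0.le a1.le a2.le (by
      linear_combination (l^2 * (1+t^2)^2) * hs)
  have := han.eq_of_eventuallyEq (analyticOnNhd_const) hev
  have h3 := congrFun this 0
  simpa [hH] using h3

theorem two_sum (c : ℕ → ℕ → ℕ → ℂ) (N M : ℕ) (hM : M ≤ N)
    (hdeg : ∀ a b d, a + b + d ≠ N → c a b d = 0)
    (l s : ℂ) (hs : s^2 = -1) (hl : l ≠ 0) (h : clearF c N M l (l * s) 0 = 0) :
    ∑ b ∈ Finset.range (N - M + 1), c (N - M - b) b M * (-s)^b = 0 := by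
  have hs0 : s ≠ 0 := by rintro rfl; simp at hs
  have e : clearF c N M l (l * s) 0 = l^(N+M) * s^N *
      ∑ b ∈ Finset.range (N - M + 1), c (N - M - b) b M * (-s)^b := by
    unfold clearF
    rw [Finset.sum_comm, Finset.mul_sum]
    have hsub : Finset.range (N - M + 1) ⊆ Finset.range (N+1) := Finset.range_mono (by omega)
    rw [← Finset.sum_subset hsub]
    · refine Finset.sum_congr rfl fun b hb => ?_
      simp only [Finset.mem_range] at hb
      rw [Finset.sum_eq_single (N - M - b)]
      · rw [Finset.sum_eq_single M]
        · have e1 : N - (N - M - b) = M + b := by omega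
          rw [e1, mul_pow]
          have e2 : s^(N-b) = s^N * (-s)^b := by
            have : s^N = s^(N-b) * s^b := by rw [← pow_add]; congr 1; omega
            rw [this, mul_assoc, ← mul_pow]
            have : s * -s = 1 := by linear_combination -hs
            rw [this]; simp
          rw [e2]
          have e3 : l^(N+M) = l^(M+b) * l^(N-b) := by rw [← pow_add]; congr 1; omega
          rw [e3]; simp; ring
        · intro d hd hdM
          simp only [Finset.mem_range] at hd
          rw [zero_pow (by omega)]; simp
        · intro h; simp at h
      · intro a _ ha
        refine Finset.sum_eq_zero fun d hd => ?_
        simp only [Finset.mem_range] at hd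
        by_cases hdM : d = M
        · rw [hdeg a b d (by omega)]; simp
        · rw [zero_pow (by omega)]; simp
      · intro h; simp only [Finset.mem_range] at h; omega
    · intro b hb hb2
      simp only [Finset.mem_range] at hb hb2
      refine Finset.sum_eq_zero fun a _ => Finset.sum_eq_zero fun d hd => ?_
      simp only [Finset.mem_range] at hd
      by_cases hdM : d = M
      · rw [hdeg a b d (by omega)]; simp
      · rw [zero_pow (by omega)]; simp
  rw [e] at h
  have : l^(N+M) * s^N ≠ 0 := mul_ne_zero (pow_ne_zero _ hl) (pow_ne_zero _ hs0)
  exact (mul_eq_zero.1 h).resolve_left this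

theorem coef_step (c : ℕ → ℕ → ℕ → ℂ) (N M : ℕ) (hM : M ≤ N)
    (hdeg : ∀ a b d, a + b + d ≠ N → c a b d = 0)
    (hharm : ∀ a b d, a + b + d + 2 = N → c (a+2) b d + c a (b+2) d + c a b (d+2) = 0)
    (hd : ∀ a b d, M < d → c a b d = 0)
    (hz : ∀ ρ : Fin 3 → ℂ, (∀ i, 2 ≤ (ρ i).re) → ∑ i, ρ i ^ 2 = 0 →
      ∑ a ∈ Finset.range (N+1), ∑ b ∈ Finset.range (N+1), ∑ d ∈ Finset.range (N+1),
        c a b d * (((ρ 0) ^ (a+1))⁻¹ * ((ρ 1) ^ (b+1))⁻¹ * ((ρ 2) ^ (d+1))⁻¹) = 0) :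
    ∀ a b, c a b M = 0 := by
  set K := N - M with hK
  have s1 : ∑ b ∈ Finset.range (K + 1), c (K - b) b M * (-Complex.I)^b = 0 := by
    refine two_sum c N M hM hdeg 3 Complex.I (by simp) (by norm_num)
      (clearF_at c N M hM hd hz 3 Complex.I (1 - Complex.I) (by simp) ?_ ?_ ?_) <;>
    simp [pow_two] <;> norm_num
  have s2 : ∑ b ∈ Finset.range (K + 1), c (K - b) b M * (- -Complex.I)^b = 0 := by
    refine two_sum c N M hM hdeg (6 * Complex.I) (-Complex.I) (by simp) (by simp)
      (clearF_at c N M hM hd hz (6 * Complex.I) (-Complex.I) (-(1 + Complex.I)/2) (by simp) ?_ ?_ ?_) <;>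
    simp [pow_two, Complex.div_re, Complex.div_im, Complex.normSq] <;> norm_num
  set g : ℕ → ℂ := fun b => c (K - b) b M with hg
  have rec' : ∀ b, b + 2 ≤ K → g (b+2) = - g b := by
    intro b hb
    have := hharm (K - (b+2)) b M (by omega)
    rw [hd _ _ (M+2) (by omega)] at this
    have e : K - (b+2) + 2 = K - b := by omega
    rw [e] at this
    simp only [hg]
    linear_combination this
  have key : ∀ (s : ℂ), s^2 = -1 → ∀ b, b ≤ K → g b * s^b = if Even b then g 0 else g 1 * s := by
    intro s hs b
    induction b using Nat.strong_induction_on with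
    | _ b ih =>
      intro hb
      match b, ih, hb with
      | 0, _, _ => simp
      | 1, _, _ => simp
      | b+2, ih, hb =>
        have h1 := ih b (by omega) (by omega)
        rw [rec' b hb, pow_add, hs]
        have : Even (b+2) ↔ Even b := by simp [Nat.even_add]
        simp only [this]
        rw [← h1]; ring
  have S : ∀ s : ℂ, s^2 = -1 → ∑ b ∈ Finset.range (K + 1), g b * s^b = 0 →
      ((Finset.range (K+1)).filter (fun b => Even b)).card * g 0 +
      ((Finset.range (K+1)).filter (fun b => ¬ Even b)).card * (g 1 * s) = 0 := by
    intro s hs h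
    rw [Finset.sum_congr rfl (fun b hb => key s hs b (by simp at hb; omega)), Finset.sum_ite] at h
    simpa using h
  have S1 := S _ (by simp) s1
  have S2 := S _ (by simp) s2
  have g0 : g 0 = 0 := by
    have h : ((((Finset.range (K+1)).filter (fun b => Even b)).card : ℕ) : ℂ) * g 0 = 0 := by
      linear_combination (S1 + S2)/2
    refine (mul_eq_zero.1 h).resolve_left ?_
    rw [← ne_eq, Nat.cast_ne_zero, Finset.card_ne_zero]
    exact ⟨0, by simp⟩
  have g1 : 1 ≤ K → g 1 = 0 := by
    intro hK1
    rw [g0] at S1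
    have h : ((((Finset.range (K+1)).filter (fun b => ¬ Even b)).card : ℕ) : ℂ) * (g 1 * (-Complex.I)) = 0 := by
      linear_combination S1
    have := (mul_eq_zero.1 h).resolve_left (by
      rw [← ne_eq, Nat.cast_ne_zero, Finset.card_ne_zero]
      exact ⟨1, by simp; omega⟩)
    simpa using this
  have gall : ∀ b ≤ K, g b = 0 := by
    intro b hb
    have := key Complex.I (by simp) b hb
    have h0 : g b * Complex.I^b = 0 := by
      rw [this]
      split_ifs with he
      · exact g0
      · rw [g1 (by rcases b with _ | b; · simp at he
                   · omega)]; simp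
    exact (mul_eq_zero.1 h0).resolve_right (by simp)
  intro a b
  by_cases hab : a + b + M = N
  · have := gall b (by omega)
    simp only [hg] at this
    have e : K - b = a := by omega
    rwa [e] at this
  · exact hdeg _ _ _ hab

theorem coef_zero (c : ℕ → ℕ → ℕ → ℂ) (N : ℕ)
    (hdeg : ∀ a b d, a + b + d ≠ N → c a b d = 0)
    (hharm : ∀ a b d, a + b + d + 2 = N → c (a+2) b d + c a (b+2) d + c a b (d+2) = 0)
    (hz : ∀ ρ : Fin 3 → ℂ, (∀ i, 2 ≤ (ρ i).re) → ∑ i, ρ i ^ 2 = 0 →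
      ∑ a ∈ Finset.range (N+1), ∑ b ∈ Finset.range (N+1), ∑ d ∈ Finset.range (N+1),
        c a b d * (((ρ 0) ^ (a+1))⁻¹ * ((ρ 1) ^ (b+1))⁻¹ * ((ρ 2) ^ (d+1))⁻¹) = 0) :
    ∀ a b d, c a b d = 0 := by
  have main : ∀ m, ∀ a b d, N < d + m → c a b d = 0 := by
    intro m
    induction m with
    | zero => intro a b d h; exact hdeg _ _ _ (by omega)
    | succ m ih =>
      intro a b d h
      by_cases h1 : N < d + m
      · exact ih a b d h1
      · have hdm : d = N - m := by omega
        exact coef_step c N d (by omega) hdeg hharm (fun a b d' h' => ih a b d' (by omega)) hz a b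
  intro a b d
  exact main (N+1) a b d (by omega)

/-- normalized one-dimensional monomial -/
noncomputable def m1 (n : ℕ) (t : ℝ) : ℂ := (t:ℂ) ^ n / (n.factorial : ℂ)

theorem m1_contDiff (n : ℕ) {m : WithTop ℕ∞} : ContDiff ℝ m (m1 n) := by
  unfold m1
  exact (Complex.ofRealCLM.contDiff.pow n).div_const _

theorem m1_cont (n : ℕ) : Continuous (m1 n) := (m1_contDiff n (m := 0)).continuous

theorem m1_deriv (n : ℕ) (t : ℝ) : HasDerivAt (m1 (n+1)) (m1 n t) t := by
  have h := ((hasDerivAt_id (t:ℂ)).comp_ofReal.pow (n+1)).div_const ((n+1).factorial : ℂ)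
  simp only [id, Pi.pow_def] at h
  refine HasDerivAt.congr_deriv h ?_
  unfold m1
  rw [Nat.factorial_succ]; push_cast
  have : (n.factorial : ℂ) ≠ 0 := by exact_mod_cast n.factorial_ne_zero
  have : (n:ℂ) + 1 ≠ 0 := by exact_mod_cast n.succ_ne_zero
  field_simp

theorem m1_exp_bound (n : ℕ) (ρ : ℂ) (hρ : 2 ≤ ρ.re) (t : ℝ) (ht : 0 ≤ t) :
    ‖m1 n t * Complex.exp (-ρ * t)‖ ≤ Real.exp (-t) := by
  rw [norm_mul, Complex.norm_exp, m1, norm_div, norm_pow, Complex.norm_real, Real.norm_of_nonneg ht,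
    Complex.norm_natCast]
  have h1 := Real.pow_div_factorial_le_exp t ht n
  have h2 : Real.exp ((-ρ * t).re) ≤ Real.exp (-(2 * t)) := by
    rw [Real.exp_le_exp]; simp; nlinarith
  calc _ ≤ Real.exp t * Real.exp (-(2*t)) := by gcongr
    _ = _ := by rw [← Real.exp_add]; congr 1; ring

theorem m1_exp_integrable (n : ℕ) (ρ : ℂ) (hρ : 2 ≤ ρ.re) :
    IntegrableOn (fun t => m1 n t * Complex.exp (-ρ * t)) (Ici 0) := by
  have h0 : IntegrableOn (fun t => Real.exp (-t)) (Ici 0) := by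
    rw [integrableOn_Ici_iff_integrableOn_Ioi]
    exact integrableOn_exp_neg_Ioi 0
  refine Integrable.mono' h0 ?_ ?_
  · have := m1_cont n
    exact Continuous.aestronglyMeasurable (by fun_prop)
  · exact (ae_restrict_iff' measurableSet_Ici).2 (Filter.Eventually.of_forall fun t ht =>
      m1_exp_bound n ρ hρ t ht)

theorem m1_exp_integral (n : ℕ) (ρ : ℂ) (hρ : 2 ≤ ρ.re) :
    ∫ t in Ici (0:ℝ), m1 n t * Complex.exp (-ρ * t) = (ρ^(n+1))⁻¹ := by
  have hρ0 : ρ ≠ 0 := by rintro rfl; simp at hρ; linarith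
  induction n with
  | zero =>
    rw [integral_Ici_eq_integral_Ioi]
    have := integral_exp_mul_complex_Ioi (a := -ρ) (by simp; linarith) 0
    simp [m1] at this ⊢
    rw [this]
  | succ n ih =>
    have hd : ∀ t ∈ Ici (0:ℝ), HasDerivAt (fun t : ℝ => m1 (n+1) t * Complex.exp (-ρ * t))
        (m1 n t * Complex.exp (-ρ * t) - ρ * (m1 (n+1) t * Complex.exp (-ρ * t))) t := by
      intro t _
      have h1 := ((hasDerivAt_id (t:ℂ)).const_mul (-ρ)).cexp.comp_ofReal
      have h2 := (m1_deriv n t).mul h1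
      refine HasDerivAt.congr_deriv h2 ?_
      simp; ring
    have hi1 := m1_exp_integrable n ρ hρ
    have hi2 := m1_exp_integrable (n+1) ρ hρ
    rw [integrableOn_Ici_iff_integrableOn_Ioi] at hi1 hi2
    have ht : Filter.Tendsto (fun t : ℝ => m1 (n+1) t * Complex.exp (-ρ * t)) Filter.atTop (nhds 0) := by
      refine squeeze_zero_norm' ?_ Real.tendsto_exp_neg_atTop_nhds_zero
      filter_upwards [Filter.eventually_ge_atTop 0] with t ht using m1_exp_bound _ ρ hρ t ht
    have := integral_Ioi_of_hasDerivAt_of_tendsto' hd (hi1.sub (hi2.const_mul ρ)) ht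
    rw [integral_sub hi1 (hi2.const_mul ρ), integral_const_mul, ← integral_Ici_eq_integral_Ioi, ih,
      ← integral_Ici_eq_integral_Ioi] at this
    have e : m1 (n+1) 0 = 0 := by simp [m1]
    rw [e] at this
    rw [pow_succ, mul_inv]
    rw [← mul_right_inj' hρ0]
    have : ρ * ∫ t in Ici (0:ℝ), m1 (n+1) t * Complex.exp (-ρ * t) = (ρ^(n+1))⁻¹ := by
      linear_combination -this
    rw [this]; field_simp

/-- normalized monomial in three variables -/
noncomputable def mono (a b d : ℕ) (x : EuclideanSpace ℝ (Fin 3)) : ℂ :=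
  m1 a (x 0) * m1 b (x 1) * m1 d (x 2)

/-- polynomial with given Taylor coefficients -/
noncomputable def polyP (c : ℕ → ℕ → ℕ → ℂ) (N : ℕ) (x : EuclideanSpace ℝ (Fin 3)) : ℂ :=
  ∑ a ∈ Finset.range (N+1), ∑ b ∈ Finset.range (N+1), ∑ d ∈ Finset.range (N+1), c a b d * mono a b d x

theorem m1p_contDiff (n : ℕ) (i : Fin 3) {m : WithTop ℕ∞} :
    ContDiff ℝ m (fun x : EuclideanSpace ℝ (Fin 3) => m1 n (x i)) :=
  (m1_contDiff n).comp (EuclideanSpace.proj (𝕜 := ℝ) i).contDiff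

theorem mono_contDiff (a b d : ℕ) {m : WithTop ℕ∞} : ContDiff ℝ m (mono a b d) := by
  unfold mono
  exact ((m1p_contDiff a 0).mul (m1p_contDiff b 1)).mul (m1p_contDiff d 2)

theorem polyP_contDiff (c : ℕ → ℕ → ℕ → ℂ) (N : ℕ) {m : WithTop ℕ∞} : ContDiff ℝ m (polyP c N) := by
  unfold polyP
  exact ContDiff.sum fun a _ => ContDiff.sum fun b _ => ContDiff.sum fun d _ =>
    contDiff_const.mul (mono_contDiff a b d)

theorem mono_cE (a b d : ℕ) (ρ : Fin 3 → ℂ) (x : EuclideanSpace ℝ (Fin 3)) :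
    mono a b d x * cE (fun i => -ρ i) x =
      ∏ i, (fun t : ℝ => m1 (![a,b,d] i) t * Complex.exp (-ρ i * t)) (x i) := by
  simp only [mono, cE, Fin.prod_univ_three, Fin.sum_univ_three, Complex.exp_add]
  simp; ring

theorem mono_cE_integrable (a b d : ℕ) (ρ : Fin 3 → ℂ) (hρ : ∀ i, 2 ≤ (ρ i).re) :
    IntegrableOn (fun x => mono a b d x * cE (fun i => -ρ i) x) octant := by
  simp only [mono_cE]
  exact integrableOn_octant_prod fun i => m1_exp_integrable _ _ (hρ i)

theorem mono_cE_integral (a b d : ℕ) (ρ : Fin 3 → ℂ) (hρ : ∀ i, 2 ≤ (ρ i).re) :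
    ∫ x in octant, mono a b d x * cE (fun i => -ρ i) x =
      ((ρ 0) ^ (a+1))⁻¹ * ((ρ 1) ^ (b+1))⁻¹ * ((ρ 2) ^ (d+1))⁻¹ := by
  simp only [mono_cE]
  rw [integral_octant_prod (fun i (t:ℝ) => m1 (![a,b,d] i) t * Complex.exp (-ρ i * t))]
  rw [Finset.prod_congr rfl fun i _ => m1_exp_integral _ _ (hρ i)]
  simp [Fin.prod_univ_three]
  ring

theorem polyP_cE_integral (c : ℕ → ℕ → ℕ → ℂ) (N : ℕ) (ρ : Fin 3 → ℂ) (hρ : ∀ i, 2 ≤ (ρ i).re) :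
    ∫ x in octant, polyP c N x * cE (fun i => -ρ i) x =
      ∑ a ∈ Finset.range (N+1), ∑ b ∈ Finset.range (N+1), ∑ d ∈ Finset.range (N+1),
        c a b d * (((ρ 0) ^ (a+1))⁻¹ * ((ρ 1) ^ (b+1))⁻¹ * ((ρ 2) ^ (d+1))⁻¹) := by
  have hi : ∀ a b d, IntegrableOn (fun x => c a b d * (mono a b d x * cE (fun i => -ρ i) x)) octant :=
    fun a b d => (mono_cE_integrable a b d ρ hρ).const_mul _
  simp only [polyP, Finset.sum_mul, mul_assoc]
  rw [integral_finsetSum]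
  · refine Finset.sum_congr rfl fun a _ => ?_
    rw [integral_finsetSum]
    · refine Finset.sum_congr rfl fun b _ => ?_
      rw [integral_finsetSum]
      · refine Finset.sum_congr rfl fun d _ => ?_
        rw [integral_const_mul, mono_cE_integral a b d ρ hρ, mul_assoc]
      · exact fun d _ => hi a b d
    · exact fun b _ => integrable_finset_sum _ fun d _ => hi a b d
  · exact fun a _ => integrable_finset_sum _ fun b _ => integrable_finset_sum _ fun d _ => hi a b d

theorem mono_smul (a b d : ℕ) (τ : ℝ) (x : EuclideanSpace ℝ (Fin 3)) :
    mono a b d (τ • x) = (τ:ℂ)^(a+b+d) * mono a b d x := by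
  simp only [mono, m1, PiLp.smul_apply, smul_eq_mul, Complex.ofReal_mul, mul_pow, pow_add]
  ring

theorem polyP_smul (c : ℕ → ℕ → ℕ → ℂ) (N : ℕ) (hdeg : ∀ a b d, a + b + d ≠ N → c a b d = 0)
    (τ : ℝ) (x : EuclideanSpace ℝ (Fin 3)) :
    polyP c N (τ • x) = (τ:ℂ)^N * polyP c N x := by
  unfold polyP
  simp only [Finset.mul_sum]
  refine Finset.sum_congr rfl fun a _ => Finset.sum_congr rfl fun b _ => Finset.sum_congr rfl fun d _ => ?_
  by_cases h : a + b + d = N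
  · rw [mono_smul, h]; ring
  · rw [hdeg _ _ _ h]; simp

theorem m1_le (n : ℕ) (t s : ℝ) (ht : 0 ≤ t) (hts : t ≤ s) : ‖m1 n t‖ ≤ s^n := by
  rw [m1, norm_div, norm_pow, Complex.norm_real, Real.norm_of_nonneg ht, Complex.norm_natCast]
  refine (div_le_self (by positivity) ?_).trans (by gcongr)
  exact_mod_cast n.factorial_pos

theorem coord_le_sL {x : EuclideanSpace ℝ (Fin 3)} (hx : x ∈ octant) (i : Fin 3) : x i ≤ sL x := by
  rw [sL_apply]
  exact Finset.single_le_sum (f := fun i => x i) (fun j _ => hx j) (Finset.mem_univ i)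

theorem mono_le (a b d : ℕ) {x : EuclideanSpace ℝ (Fin 3)} (hx : x ∈ octant) :
    ‖mono a b d x‖ ≤ (sL x)^(a+b+d) := by
  have h := sL_nonneg hx
  have e0 := m1_le a (x 0) (sL x) (hx 0) (coord_le_sL hx 0)
  have e1 := m1_le b (x 1) (sL x) (hx 1) (coord_le_sL hx 1)
  have e2 := m1_le d (x 2) (sL x) (hx 2) (coord_le_sL hx 2)
  rw [mono, norm_mul, norm_mul, pow_add, pow_add]
  gcongr

theorem polyP_le (c : ℕ → ℕ → ℕ → ℂ) (N : ℕ) (hdeg : ∀ a b d, a + b + d ≠ N → c a b d = 0) :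
    ∃ κ' : ℝ, 0 ≤ κ' ∧ ∀ x ∈ octant, ‖polyP c N x‖ ≤ κ' * (sL x)^N := by
  refine ⟨∑ a ∈ Finset.range (N+1), ∑ b ∈ Finset.range (N+1), ∑ d ∈ Finset.range (N+1), ‖c a b d‖,
    by positivity, fun x hx => ?_⟩
  unfold polyP
  simp only [Finset.sum_mul]
  refine (norm_sum_le _ _).trans (Finset.sum_le_sum fun a _ => ?_)
  refine (norm_sum_le _ _).trans (Finset.sum_le_sum fun b _ => ?_)
  refine (norm_sum_le _ _).trans (Finset.sum_le_sum fun d _ => ?_)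
  rw [norm_mul]
  by_cases h : a + b + d = N
  · have := mono_le a b d hx
    rw [h] at this
    gcongr
  · rw [hdeg _ _ _ h]; simp

/-- regularized Newton kernel in four dimensions -/
noncomputable def Ker (s : ℝ) (x y : EuclideanSpace ℝ (Fin 4)) : ℝ := (‖y - x‖^2 + s)⁻¹

theorem Ker_contDiff {s : ℝ} (hs : 0 < s) (x : EuclideanSpace ℝ (Fin 4)) {n : WithTop ℕ∞} :
    ContDiff ℝ n (Ker s x) := by
  unfold Ker
  refine ContDiff.inv ?_ (fun y => by positivity)
  exact ((contDiff_id.sub contDiff_const).norm_sq ℝ).add contDiff_const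

theorem pd_Ker {s : ℝ} (hs : 0 < s) (x : EuclideanSpace ℝ (Fin 4)) (i : Fin 4) :
    pd (ei i) (Ker s x) = fun y => -2 * ((y i - x i) * (Ker s x y * Ker s x y)) := by
  ext y
  have h1 : HasFDerivAt (fun y : EuclideanSpace ℝ (Fin 4) => ‖y - x‖^2 + s)
      ((2 • (innerSL ℝ (y - x))).comp (ContinuousLinearMap.id ℝ _)) y := by
    have a1 : HasFDerivAt (fun z : EuclideanSpace ℝ (Fin 4) => ‖z‖^2) (2 • (innerSL ℝ (y - x))) (y - x) :=
      (hasStrictFDerivAt_norm_sq (y - x)).hasFDerivAt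
    have a2 : HasFDerivAt (fun z : EuclideanSpace ℝ (Fin 4) => z - x) (ContinuousLinearMap.id ℝ _) y :=
      (hasFDerivAt_id y).sub_const x
    exact (HasFDerivAt.comp y a1 a2).add_const s
  have h2 := (hasDerivAt_inv (show ‖y - x‖^2 + s ≠ 0 by positivity)).comp_hasFDerivAt y h1
  have h3 := h2.fderiv
  change fderiv ℝ (fun y => (‖y - x‖^2 + s)⁻¹) y (ei i) = _
  simp only [Function.comp_def] at h3
  rw [h3]
  simp [EuclideanSpace.inner_single_right, Ker, pow_two]
  ring

theorem pd_coord (x : EuclideanSpace ℝ (Fin 4)) (i : Fin 4) :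
    pd (ei i) (fun y : EuclideanSpace ℝ (Fin 4) => y i - x i) = fun _ => 1 := by
  ext y
  have h := ((EuclideanSpace.proj (𝕜 := ℝ) i : EuclideanSpace ℝ (Fin 4) →L[ℝ] ℝ).hasFDerivAt (x := y)).sub_const (x i)
  have h3 := h.fderiv
  change fderiv ℝ (fun y : EuclideanSpace ℝ (Fin 4) => (EuclideanSpace.proj (𝕜 := ℝ) i : EuclideanSpace ℝ (Fin 4) →L[ℝ] ℝ) y - x i) y (ei i) = _
  rw [h3]; simp

theorem lap_Ker {s : ℝ} (hs : 0 < s) (x : EuclideanSpace ℝ (Fin 4)) :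
    lap (Ker s x) = fun y => -(8 * s * Ker s x y ^ 3) := by
  ext y
  have hK : Differentiable ℝ (Ker s x) := (Ker_contDiff hs x (n := 1)).differentiable (by norm_num)
  have hKK : Differentiable ℝ (fun y => Ker s x y * Ker s x y) := hK.mul hK
  have hc : ∀ i : Fin 4, Differentiable ℝ (fun y : EuclideanSpace ℝ (Fin 4) => y i - x i) := by
    intro i; fun_prop
  have hcKK : ∀ i : Fin 4, Differentiable ℝ (fun y => (y i - x i) * (Ker s x y * Ker s x y)) :=
    fun i => (hc i).mul hKK
  simp only [lap]
  have e : ∀ i : Fin 4, pd (ei i) (pd (ei i) (Ker s x)) y =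
      -2 * Ker s x y ^ 2 + 8 * (y i - x i)^2 * Ker s x y ^ 3 := by
    intro i
    rw [pd_Ker hs, pd_const_mul (hcKK i), pd_mul (hc i) hKK, pd_mul hK hK, pd_coord, pd_Ker hs]
    ring
  rw [Finset.sum_congr rfl fun i _ => e i, Finset.sum_add_distrib, ← Finset.sum_mul, ← Finset.sum_mul, ← Finset.mul_sum]
  have hn : ∑ i, (y i - x i)^2 = ‖y - x‖^2 := by
    rw [EuclideanSpace.real_norm_sq_eq]; simp
  have hk : Ker s x y * (‖y - x‖^2 + s) = 1 := by
    unfold Ker; rw [inv_mul_cancel₀]; positivity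
  rw [hn]
  simp
  linear_combination (8 * Ker s x y ^ 2) * hk

theorem green_id {U χ : EuclideanSpace ℝ (Fin 4) → ℝ} (hU : ContDiff ℝ 2 U) (hh : ∀ x, lap U x = 0)
    (hχ : ContDiff ℝ 2 χ) (hc : HasCompactSupport χ) {s : ℝ} (hs : 0 < s)
    (x : EuclideanSpace ℝ (Fin 4)) :
    ∫ y, 8 * s * Ker s x y ^ 3 * (χ y * U y) =
      ∫ y, (U y * lap χ y * Ker s x y + ∑ i, (-4 * U y * pd (ei i) χ y) * ((y i - x i) * Ker s x y ^ 2)) := by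
  have hK := Ker_contDiff hs x (n := 2)
  have h := integral_lap_mul hU (hχ.mul hK) hc.mul_right
  rw [lap_mul hχ hK, lap_Ker hs] at h
  simp only [hh, zero_mul, integral_zero, pd_Ker hs] at h
  rw [← sub_eq_zero, ← neg_eq_zero, ← integral_sub, ← integral_neg]
  · rw [← h]
    congr 1
    ext y
    simp only [Finset.mul_sum, mul_add]
    have : ∀ i : Fin 4, U y * (2 * (pd (ei i) χ y * (-2 * ((y i - x i) * (Ker s x y * Ker s x y))))) =
      -4 * U y * pd (ei i) χ y * ((y i - x i) * Ker s x y ^ 2) := fun i => by ring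
    rw [Finset.sum_congr rfl fun i _ => this i]
    ring
  · refine Continuous.integrable_of_hasCompactSupport ?_ (HasCompactSupport.mul_left (hc.mul_right))
    have := hU.continuous
    have := hχ.continuous
    have := hK.continuous
    fun_prop
  · have h1 := hU.continuous
    have h3 := hK.continuous
    have h4 := lap_continuous hχ
    have h5 := fun i : Fin 4 => pd_continuous (hχ.of_le (by norm_num)) (ei i)
    have c1 : ∀ i, HasCompactSupport (pd (ei i) χ) := fun i => pd_support hc _
    refine Integrable.add ?_ ?_
    · refine Continuous.integrable_of_hasCompactSupport (by fun_prop) ?_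
      refine HasCompactSupport.mul_right (HasCompactSupport.mul_left ?_)
      refine HasCompactSupport.intro hc fun y hy => ?_
      refine Finset.sum_eq_zero fun i _ => ?_
      have e : ∀ᶠ z in nhds y, pd (ei i) χ z = 0 := by
        filter_upwards [(isClosed_tsupport χ).isOpen_compl.mem_nhds hy] with z hz
        have : χ =ᶠ[nhds z] fun _ => 0 := notMem_tsupport_iff_eventuallyEq.1 hz
        simp [pd, this.fderiv_eq]
      have e2 : pd (ei i) χ =ᶠ[nhds y] fun _ => 0 := e
      change fderiv ℝ (pd (ei i) χ) y _ = 0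
      rw [e2.fderiv_eq]; simp
    · refine integrable_finset_sum _ fun i _ => ?_
      refine Continuous.integrable_of_hasCompactSupport ?_ ?_
      · have := h5 i
        fun_prop
      · exact HasCompactSupport.mul_right (HasCompactSupport.mul_left (c1 i))

/-- the unnormalized peak function -/
noncomputable def pk (z : EuclideanSpace ℝ (Fin 4)) : ℝ := 8 * ((1 + ‖z‖^2)^3)⁻¹

theorem pk_cont : Continuous pk := by
  unfold pk
  refine continuous_const.mul (Continuous.inv₀ (by fun_prop) fun z => by positivity)

theorem pk_pos (z : EuclideanSpace ℝ (Fin 4)) : 0 < pk z := by unfold pk; positivity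

theorem pk_integrable : Integrable pk := by
  have h := integrable_rpow_neg_one_add_norm_sq (E := EuclideanSpace ℝ (Fin 4)) (μ := volume) (r := 6)
    (by simp; norm_num)
  refine (h.const_mul 8).congr (Filter.Eventually.of_forall fun z => ?_)
  simp only [pk]
  congr 1
  rw [show (-6/2 : ℝ) = -(3:ℕ) by norm_num, Real.rpow_neg (by positivity), Real.rpow_natCast]

theorem pk_int_pos : 0 < ∫ z, pk z := by
  refine (integral_pos_iff_support_of_nonneg (fun z => (pk_pos z).le) pk_integrable).2 ?_
  have : Function.support pk = Set.univ := by
    ext z; simp [(pk_pos z).ne']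
  rw [this]; simp

theorem pk_decay (C0 : ℝ) (hC : 0 < C0) :
    Filter.Tendsto (fun z : EuclideanSpace ℝ (Fin 4) => ‖z‖^4 * (C0⁻¹ * pk z))
      (Bornology.cobounded _) (nhds 0) := by
  have h0 : Filter.Tendsto (fun z : EuclideanSpace ℝ (Fin 4) => (C0⁻¹ * 8) * ‖z‖⁻¹)
      (Bornology.cobounded _) (nhds 0) := by
    have := (tendsto_inv_atTop_zero.comp (tendsto_norm_cobounded_atTop (E := EuclideanSpace ℝ (Fin 4)))).const_mul (C0⁻¹ * 8)
    simpa using this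
  refine squeeze_zero' (Filter.Eventually.of_forall fun z => by have := pk_pos z; positivity) ?_ h0
  have h1 : ∀ᶠ z : EuclideanSpace ℝ (Fin 4) in Bornology.cobounded _, 1 ≤ ‖z‖ :=
    tendsto_norm_cobounded_atTop.eventually_ge_atTop 1
  filter_upwards [h1] with z hz
  simp only [pk]
  have hz0 : 0 < ‖z‖ := by linarith
  have : ‖z‖^4 * ((1+‖z‖^2)^3)⁻¹ ≤ ‖z‖⁻¹ := by
    rw [← div_eq_mul_inv, div_le_iff₀ (by positivity), inv_mul_eq_div, le_div_iff₀ hz0]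
    have h6 : (‖z‖^2)^3 ≤ (1+‖z‖^2)^3 := by gcongr; linarith
    have h5 : ‖z‖^5 ≤ ‖z‖^6 := pow_le_pow_right₀ hz (by norm_num)
    calc ‖z‖^4 * ‖z‖ = ‖z‖^5 := by ring
      _ ≤ ‖z‖^6 := h5
      _ = (‖z‖^2)^3 := by ring
      _ ≤ _ := h6
  calc ‖z‖^4 * (C0⁻¹ * (8 * ((1+‖z‖^2)^3)⁻¹)) = (C0⁻¹ * 8) * (‖z‖^4 * ((1+‖z‖^2)^3)⁻¹) := by ring
    _ ≤ _ := by gcongr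

theorem pk_scale (c : ℝ) (hcpos : 0 < c) (x y : EuclideanSpace ℝ (Fin 4)) :
    c^4 * pk (c • (x - y)) = 8 * (c^2)⁻¹ * Ker (c^2)⁻¹ x y ^ 3 := by
  simp only [pk, Ker]
  rw [norm_smul, Real.norm_of_nonneg hcpos.le, norm_sub_rev]
  have e : ‖y - x‖^2 + (c^2)⁻¹ = (c^2)⁻¹ * (1 + (c * ‖y - x‖)^2) := by field_simp; ring
  rw [e]
  have : 0 < 1 + (c * ‖y - x‖)^2 := by positivity
  field_simp

theorem peak_tendsto {g : EuclideanSpace ℝ (Fin 4) → ℝ} (hg : Continuous g) (hc : HasCompactSupport g)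
    (x : EuclideanSpace ℝ (Fin 4)) :
    Filter.Tendsto (fun c : ℝ => ∫ y, 8 * (c^2)⁻¹ * Ker (c^2)⁻¹ x y ^ 3 * g y) Filter.atTop
      (nhds ((∫ z, pk z) * g x)) := by
  obtain ⟨C0, hC0⟩ : ∃ C0 : ℝ, C0 = ∫ z, pk z := ⟨_, rfl⟩
  have hC : 0 < C0 := by rw [hC0]; exact pk_int_pos
  have hn : Module.finrank ℝ (EuclideanSpace ℝ (Fin 4)) = 4 := by simp
  have key := tendsto_integral_comp_smul_smul_of_integrable' (μ := (volume : Measure (EuclideanSpace ℝ (Fin 4))))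
    (φ := fun z => C0⁻¹ * pk z) (fun z => by have := pk_pos z; positivity)
    (by rw [integral_const_mul, ← hC0]; exact inv_mul_cancel₀ hC.ne')
    (by rw [hn]; exact pk_decay C0 hC)
    (g := g) (x₀ := x) (hg.integrable_of_hasCompactSupport hc) hg.continuousAt
  rw [hn] at key
  rw [← hC0]
  have k2 := key.const_mul C0
  refine k2.congr' ?_
  filter_upwards [Filter.eventually_gt_atTop 0] with c hcpos
  rw [← integral_const_mul]
  congr 1
  ext y
  rw [← pk_scale c hcpos, smul_eq_mul]
  field_simp

section Functional
variable (S : Set (EuclideanSpace ℝ (Fin 4))) [hSc : CompactSpace S]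

/-- integration functional -/
theorem exists_functional (hS : IsCompact S) (w : EuclideanSpace ℝ (Fin 4) → ℝ) (hw : Continuous w)
    (h0 : ∀ y ∉ S, w y = 0) :
    ∃ Λ : C(S, ℝ) →L[ℝ] ℝ, ∀ (f : C(S, ℝ)) (F : EuclideanSpace ℝ (Fin 4) → ℝ),
      (∀ y : S, f y = F y) → Λ f = ∫ y, w y * F y := by
  have hm : MeasurableSet S := hS.measurableSet
  set μ : Measure S := Measure.comap Subtype.val volume with hμ
  haveI : IsFiniteMeasure μ := by
    constructor
    rw [hμ, comap_subtype_coe_apply hm]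
    simpa using hS.measure_lt_top
  have hwint : ∀ f : C(S, ℝ), Integrable (fun y : S => w y * f y) μ := by
    intro f
    let ff : C(S, ℝ) := ⟨fun y => w y * f y, by fun_prop⟩
    exact ff.continuous.integrable_of_hasCompactSupport (HasCompactSupport.of_compactSpace _)
  have hwi : Integrable (fun y : S => ‖w y‖) μ := by
    have : Continuous (fun y : S => ‖w y‖) := by fun_prop
    exact this.integrable_of_hasCompactSupport (HasCompactSupport.of_compactSpace _)
  let L : C(S, ℝ) →ₗ[ℝ] ℝ :=
    { toFun := fun f => ∫ y : S, w y * f y ∂μ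
      map_add' := fun f g => by
        simp only [ContinuousMap.add_apply, mul_add]
        exact integral_add (hwint f) (hwint g)
      map_smul' := fun c f => by
        simp only [ContinuousMap.smul_apply, smul_eq_mul, RingHom.id_apply]
        rw [← integral_const_mul]; congr 1; ext y; ring }
  refine ⟨L.mkContinuous (∫ y : S, ‖w y‖ ∂μ) ?_, ?_⟩
  · intro f
    change ‖∫ y : S, w y * f y ∂μ‖ ≤ _
    refine (norm_integral_le_integral_norm _).trans ?_
    rw [← integral_mul_const]
    refine integral_mono (hwint f).norm (hwi.mul_const _) fun y => ?_
    simp only [norm_mul]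
    exact mul_le_mul_of_nonneg_left (f.norm_coe_le_norm y) (norm_nonneg _)
  · intro f F hF
    change ∫ y : S, w y * f y ∂μ = _
    rw [integral_congr_ae (Filter.Eventually.of_forall fun y => by
      simp only [hF y] : (fun y : S => w y * f y) =ᵐ[μ] fun y : S => w y * F y)]
    rw [hμ, integral_subtype_comap hm (fun y => w y * F y)]
    exact setIntegral_eq_integral_of_forall_compl_eq_zero fun y hy => by rw [h0 y hy, zero_mul]
end Functional

section Rep
variable (S : Set (EuclideanSpace ℝ (Fin 4))) [hSc : CompactSpace S]

/-- coordinate function in the algebra of continuous functions -/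
noncomputable def Yc (i : Fin 4) : C(S, ℝ) := ⟨fun y => y.1 i, by fun_prop⟩

/-- shifted coordinate -/
noncomputable def Yx (i : Fin 4) (p : EuclideanSpace ℝ (Fin 4) × ℝ) : C(S, ℝ) :=
  Yc S i - p.1 i • (1 : C(S, ℝ))

/-- regularized squared distance -/
noncomputable def Ax (p : EuclideanSpace ℝ (Fin 4) × ℝ) : C(S, ℝ) :=
  ∑ i, Yx S i p ^ 2 + p.2 • (1 : C(S, ℝ))

theorem Yx_apply (i : Fin 4) (p : EuclideanSpace ℝ (Fin 4) × ℝ) (y : S) :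
    Yx S i p y = y.1 i - p.1 i := by
  simp [Yx, Yc]

theorem Ax_apply (p : EuclideanSpace ℝ (Fin 4) × ℝ) (y : S) :
    Ax S p y = ‖y.1 - p.1‖^2 + p.2 := by
  simp [Ax, ContinuousMap.sum_apply, Yx_apply, EuclideanSpace.real_norm_sq_eq]

theorem Yx_analytic (i : Fin 4) (p : EuclideanSpace ℝ (Fin 4) × ℝ) : AnalyticAt ℝ (Yx S i) p := by
  have h : AnalyticAt ℝ (fun p : EuclideanSpace ℝ (Fin 4) × ℝ => p.1 i • (1 : C(S, ℝ))) p :=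
    (((EuclideanSpace.proj (𝕜 := ℝ) i : EuclideanSpace ℝ (Fin 4) →L[ℝ] ℝ).comp
      (ContinuousLinearMap.fst ℝ (EuclideanSpace ℝ (Fin 4)) ℝ)).smulRight (1 : C(S, ℝ))).analyticAt p
  exact analyticAt_const.sub h

theorem Ax_analytic (p : EuclideanSpace ℝ (Fin 4) × ℝ) : AnalyticAt ℝ (Ax S) p := by
  have h : AnalyticAt ℝ (fun p : EuclideanSpace ℝ (Fin 4) × ℝ => p.2 • (1 : C(S, ℝ))) p :=
    ((ContinuousLinearMap.snd ℝ (EuclideanSpace ℝ (Fin 4)) ℝ).smulRight (1 : C(S, ℝ))).analyticAt p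
  have h2 : AnalyticAt ℝ (fun p : EuclideanSpace ℝ (Fin 4) × ℝ => ∑ i, Yx S i p ^ 2) p :=
    Finset.analyticAt_fun_sum _ fun i _ => (Yx_analytic S i p).fun_pow 2
  exact h2.add h

theorem Ax_unit (p : EuclideanSpace ℝ (Fin 4) × ℝ) (h : ∀ y ∈ S, ‖y - p.1‖^2 + p.2 ≠ 0) :
    IsUnit (Ax S p) := by
  rw [ContinuousMap.isUnit_iff_forall_ne_zero]
  intro y
  rw [Ax_apply]; exact h y.1 y.2

theorem Ax_inv_apply (p : EuclideanSpace ℝ (Fin 4) × ℝ) (h : ∀ y ∈ S, ‖y - p.1‖^2 + p.2 ≠ 0) (y : S) :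
    Ring.inverse (Ax S p) y = Ker p.2 p.1 y.1 := by
  have h1 := Ring.mul_inverse_cancel _ (Ax_unit S p h)
  have h2 := congrArg (fun f : C(S, ℝ) => f y) h1
  simp only [ContinuousMap.mul_apply, ContinuousMap.one_apply, Ax_apply] at h2
  unfold Ker
  exact eq_inv_of_mul_eq_one_right h2

theorem Ax_inv_analytic (p : EuclideanSpace ℝ (Fin 4) × ℝ) (h : ∀ y ∈ S, ‖y - p.1‖^2 + p.2 ≠ 0) :
    AnalyticAt ℝ (fun p => Ring.inverse (Ax S p)) p := by
  obtain ⟨u, hu⟩ := Ax_unit S p h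
  have h1 : AnalyticAt ℝ Ring.inverse (Ax S p) := by rw [← hu]; exact analyticAt_inverse u
  exact h1.comp (Ax_analytic S p)
end Rep

theorem analytic_harmonic4 {U : EuclideanSpace ℝ (Fin 4) → ℝ} (hU : ContDiff ℝ 2 U)
    (hh : ∀ x, lap U x = 0) (x0 : EuclideanSpace ℝ (Fin 4)) : AnalyticAt ℝ U x0 := by
  let χb : ContDiffBump x0 := ⟨1, 2, by norm_num, by norm_num⟩
  obtain ⟨χ, hχdef⟩ : ∃ χ : EuclideanSpace ℝ (Fin 4) → ℝ, χ = χb := ⟨_, rfl⟩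
  have hχ : ContDiff ℝ 2 χ := by rw [hχdef]; exact χb.contDiff
  have hc : HasCompactSupport χ := by rw [hχdef]; exact χb.hasCompactSupport
  have h1 : ∀ y ∈ ball x0 1, χ y = 1 := fun y hy => by
    rw [hχdef]; exact χb.one_of_mem_closedBall (ball_subset_closedBall hy)
  have h2 : ∀ y ∉ closedBall x0 2, χ y = 0 := fun y hy => by
    rw [hχdef]; refine χb.zero_of_le_dist ?_
    simp only [mem_closedBall, not_le] at hy; exact hy.le
  set S : Set (EuclideanSpace ℝ (Fin 4)) := closedBall x0 2 \ ball x0 1 with hSdef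
  have hS : IsCompact S := (isCompact_closedBall x0 2).diff isOpen_ball
  haveI : CompactSpace S := isCompact_iff_compactSpace.1 hS
  have hloc : ∀ y ∉ S, ∃ a : ℝ, χ =ᶠ[nhds y] fun _ => a := by
    intro y hy
    by_cases hb : y ∈ ball x0 1
    · exact ⟨1, by filter_upwards [isOpen_ball.mem_nhds hb] with z hz using h1 z hz⟩
    · have : y ∉ closedBall x0 2 := fun h => hy ⟨h, hb⟩
      exact ⟨0, by filter_upwards [isClosed_closedBall.isOpen_compl.mem_nhds this] with z hz using h2 z hz⟩
  have hpd : ∀ i, ∀ y ∉ S, pd (ei i) χ y = 0 := by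
    intro i y hy
    obtain ⟨a, ha⟩ := hloc y hy
    simp [pd, ha.fderiv_eq]
  have hlap : ∀ y ∉ S, lap χ y = 0 := by
    intro y hy
    refine Finset.sum_eq_zero fun i _ => ?_
    have : pd (ei i) χ =ᶠ[nhds y] fun _ => 0 := by
      filter_upwards [hS.isClosed.isOpen_compl.mem_nhds hy] with z hz using hpd i z hz
    change fderiv ℝ (pd (ei i) χ) y _ = 0
    rw [this.fderiv_eq]; simp
  have c0 := lap_continuous hχ
  have ci := fun i : Fin 4 => pd_continuous (hχ.of_le (by norm_num)) (ei i)
  have cU := hU.continuous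
  have w0c : Continuous (fun y => U y * lap χ y) := cU.mul c0
  have wic : ∀ i : Fin 4, Continuous (fun y => -4 * U y * pd (ei i) χ y) := fun i =>
    (continuous_const.mul cU).mul (ci i)
  have w0s : ∀ y ∉ S, U y * lap χ y = 0 := fun y hy => by rw [hlap y hy, mul_zero]
  have wis : ∀ i : Fin 4, ∀ y ∉ S, -4 * U y * pd (ei i) χ y = 0 := fun i y hy => by
    rw [hpd i y hy, mul_zero]
  obtain ⟨Λ0, hΛ0⟩ := exists_functional S hS _ w0c w0s
  choose Λ hΛ using fun i => exists_functional S hS _ (wic i) (wis i)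
  set R : EuclideanSpace ℝ (Fin 4) × ℝ → ℝ := fun p => Λ0 (Ring.inverse (Ax S p)) +
    ∑ i, Λ i (Yx S i p * Ring.inverse (Ax S p) ^ 2) with hR
  have hne : ∀ x ∈ ball x0 (1/2), ∀ s : ℝ, 0 ≤ s → ∀ y ∈ S, ‖y - x‖^2 + s ≠ 0 := by
    intro x hx s hs y hy
    have a1 : 1 ≤ dist y x0 := by simpa using hy.2
    have a2 : dist x x0 < 1/2 := hx
    have a3 := dist_triangle y x x0
    have : 0 < ‖y - x‖ := by rw [← dist_eq_norm]; linarith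
    positivity
  have hRa : ∀ x ∈ ball x0 (1/2), AnalyticAt ℝ R (x, 0) := by
    intro x hx
    have hi := Ax_inv_analytic S (x, 0) (hne x hx 0 le_rfl)
    refine AnalyticAt.add ((Λ0.analyticAt _).comp hi) ?_
    refine Finset.analyticAt_fun_sum _ fun i _ => ?_
    exact ((Λ i).analyticAt _).comp ((Yx_analytic S i (x, 0)).mul (hi.fun_pow 2))
  have hgreen : ∀ x ∈ ball x0 (1/2), ∀ s : ℝ, 0 < s →
      ∫ y, 8 * s * Ker s x y ^ 3 * (χ y * U y) = R (x, s) := by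
    intro x hx s hs
    have hKc := (Ker_contDiff hs x (n := 0)).continuous
    rw [green_id hU hh hχ hc hs x, integral_add, integral_finsetSum]
    · simp only [hR]
      congr 1
      · exact (hΛ0 _ _ fun y => Ax_inv_apply S (x, s) (hne x hx s hs.le) y).symm
      · refine Finset.sum_congr rfl fun i _ => ?_
        refine (hΛ i _ _ fun y => ?_).symm
        rw [ContinuousMap.mul_apply, ContinuousMap.pow_apply, Ax_inv_apply S (x, s) (hne x hx s hs.le) y,
          Yx_apply]
    · intro i _
      refine Continuous.integrable_of_hasCompactSupport ((wic i).mul (by fun_prop)) ?_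
      exact HasCompactSupport.intro hS fun y hy => by rw [wis i y hy, zero_mul]
    · refine Continuous.integrable_of_hasCompactSupport (w0c.mul hKc) ?_
      exact HasCompactSupport.intro hS fun y hy => by rw [w0s y hy, zero_mul]
    · refine integrable_finset_sum _ fun i _ => ?_
      refine Continuous.integrable_of_hasCompactSupport ((wic i).mul (by fun_prop)) ?_
      exact HasCompactSupport.intro hS fun y hy => by rw [wis i y hy, zero_mul]
  have hfin : ∀ x ∈ ball x0 (1/2), U x = (∫ z, pk z)⁻¹ * R (x, 0) := by
    intro x hx
    have t1 := peak_tendsto (hχ.continuous.mul cU) hc.mul_right x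
    have t2 : Filter.Tendsto (fun c : ℝ => R (x, (c^2)⁻¹)) Filter.atTop (nhds (R (x, 0))) := by
      have e : Filter.Tendsto (fun c : ℝ => (x, (c^2)⁻¹)) Filter.atTop (nhds (x, (0:ℝ))) := by
        refine Filter.Tendsto.prodMk_nhds tendsto_const_nhds ?_
        exact tendsto_inv_atTop_zero.comp (Filter.tendsto_pow_atTop (by norm_num))
      exact (hRa x hx).continuousAt.tendsto.comp e
    have t3 : Filter.Tendsto (fun c : ℝ => R (x, (c^2)⁻¹)) Filter.atTop
        (nhds ((∫ z, pk z) * (χ x * U x))) := by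
      refine t1.congr' ?_
      filter_upwards [Filter.eventually_gt_atTop 0] with c hcp
      exact hgreen x hx _ (by positivity)
    have := tendsto_nhds_unique t2 t3
    rw [this, h1 x (ball_subset_ball (by norm_num) hx), one_mul, inv_mul_cancel_left₀ pk_int_pos.ne']
  have ha : AnalyticAt ℝ (fun x => (∫ z, pk z)⁻¹ * R (x, 0)) x0 := by
    refine analyticAt_const.mul ?_
    have := hRa x0 (mem_ball_self (by norm_num))
    exact this.comp₂ (analyticAt_id) analyticAt_const
  refine ha.congr ?_
  filter_upwards [ball_mem_nhds x0 (show (0:ℝ) < 1/2 by norm_num)] with x hx using (hfin x hx).symm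

theorem pd_comp_clm {V W F : Type*} [NormedAddCommGroup V] [NormedSpace ℝ V]
    [NormedAddCommGroup W] [NormedSpace ℝ W] [NormedAddCommGroup F] [NormedSpace ℝ F]
    {f : W → F} (hf : Differentiable ℝ f) (L : V →L[ℝ] W) (v : V) :
    pd v (fun x => f (L x)) = fun x => pd (L v) f (L x) := by
  ext x
  simp only [pd]
  have := ((hf (L x)).hasFDerivAt).comp x (L.hasFDerivAt (x := x))
  have h2 := this.fderiv
  simp only [Function.comp_def] at h2
  rw [h2]; simp

/-- projection to the first three coordinates -/
noncomputable def prj : EuclideanSpace ℝ (Fin 4) →L[ℝ] EuclideanSpace ℝ (Fin 3) :=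
  ∑ i : Fin 3, (EuclideanSpace.proj (𝕜 := ℝ) i.castSucc :
    EuclideanSpace ℝ (Fin 4) →L[ℝ] ℝ).smulRight (ei i)

/-- inclusion of the first three coordinates -/
noncomputable def inj3 : EuclideanSpace ℝ (Fin 3) →L[ℝ] EuclideanSpace ℝ (Fin 4) :=
  ∑ i : Fin 3, (EuclideanSpace.proj (𝕜 := ℝ) i :
    EuclideanSpace ℝ (Fin 3) →L[ℝ] ℝ).smulRight (ei i.castSucc)

theorem prj_ei_cast (i : Fin 3) : prj (ei i.castSucc) = ei i := by
  ext j; simp [prj, sum_apply, Pi.single_apply, eq_comm]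

theorem prj_ei_last : prj (ei (Fin.last 3)) = 0 := by
  ext j; simp [prj, sum_apply, Pi.single_apply, Fin.sum_univ_three]

theorem prj_inj (x : EuclideanSpace ℝ (Fin 3)) : prj (inj3 x) = x := by
  simp only [inj3, sum_apply, ContinuousLinearMap.smulRight_apply, map_sum, map_smul, prj_ei_cast]
  ext j; simp [Pi.single_apply]

theorem inj_last (x : EuclideanSpace ℝ (Fin 3)) : inj3 x (Fin.last 3) = 0 := by
  simp [inj3, sum_apply, Pi.single_apply, Fin.sum_univ_three]

/-- last coordinate -/
noncomputable def lastL : EuclideanSpace ℝ (Fin 4) →L[ℝ] ℝ := EuclideanSpace.proj (𝕜 := ℝ) (Fin.last 3)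

theorem analytic_helmholtz_real (k : ℝ) {f : EuclideanSpace ℝ (Fin 3) → ℝ} (hf : ContDiff ℝ 2 f)
    (hh : ∀ x, lap f x + k^2 * f x = 0) (x0 : EuclideanSpace ℝ (Fin 3)) : AnalyticAt ℝ f x0 := by
  have hfd := hf.differentiable (by norm_num)
  set ex : ℝ → ℝ := fun t => Real.exp (k * t) with hex
  have hexd : ∀ t, HasDerivAt ex (k * ex t) t := by
    intro t
    have := ((hasDerivAt_id t).const_mul k).exp
    refine HasDerivAt.congr_deriv this ?_
    simp [hex]; ring
  have hexc : ContDiff ℝ 2 ex := (contDiff_const.mul contDiff_id).exp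
  have hexD : Differentiable ℝ ex := hexc.differentiable (by norm_num)
  have pdex : ∀ v : ℝ, pd v ex = fun t => (v * k) * ex t := by
    intro v; ext t
    simp only [pd, (hexd t).hasFDerivAt.fderiv]
    simp; ring
  have hF : ContDiff ℝ 2 (fun y => f (prj y)) := hf.comp prj.contDiff
  have hG : ContDiff ℝ 2 (fun y => ex (lastL y)) := hexc.comp lastL.contDiff
  have l1 : ∀ i : Fin 3, lastL (ei i.castSucc) = 0 := by
    intro i; fin_cases i <;> simp [lastL, Pi.single_apply]
  have l2 : lastL (ei (Fin.last 3)) = 1 := by simp [lastL]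
  have pF : ∀ i : Fin 4, pd (ei i) (fun y => f (prj y)) = fun y => pd (prj (ei i)) f (prj y) :=
    fun i => pd_comp_clm hfd prj _
  have pG : ∀ i : Fin 4, pd (ei i) (fun y => ex (lastL y)) = fun y => (lastL (ei i) * k) * ex (lastL y) := by
    intro i; rw [pd_comp_clm hexD lastL, pdex]
  have pz : ∀ (g : EuclideanSpace ℝ (Fin 3) → ℝ) x, pd 0 g x = 0 := by intro g x; simp [pd]
  have hU : ContDiff ℝ 2 (fun y => f (prj y) * ex (lastL y)) := hF.mul hG
  have lapF : ∀ y, lap (fun y => f (prj y)) y = lap f (prj y) := by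
    intro y
    simp only [lap]
    rw [Fin.sum_univ_castSucc]
    simp only [pF, prj_ei_cast, prj_ei_last, pz]
    have : pd (ei (Fin.last 3)) (fun _ : EuclideanSpace ℝ (Fin 4) => (0:ℝ)) y = 0 := by simp [pd]
    rw [this, add_zero]
    refine Finset.sum_congr rfl fun i _ => ?_
    rw [pd_comp_clm ((pd_contDiff_one hf _).differentiable (by norm_num)), prj_ei_cast]
  have lapG : ∀ y, lap (fun y => ex (lastL y)) y = k^2 * ex (lastL y) := by
    intro y
    simp only [lap]
    have hGd := hG.differentiable (by norm_num)
    simp only [pG, pd_const_mul hGd]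
    rw [Fin.sum_univ_castSucc]
    simp only [l1, l2]
    simp; ring
  have hharm : ∀ y, lap (fun y => f (prj y) * ex (lastL y)) y = 0 := by
    intro y
    rw [lap_mul hF hG]
    simp only [lapF, lapG, pF, pG]
    rw [Fin.sum_univ_castSucc]
    simp only [l1, prj_ei_last, pz]
    simp
    linear_combination (ex (lastL y)) * hh (prj y)
  have hA := analytic_harmonic4 hU hharm (inj3 x0)
  have hB := hA.comp (inj3.analyticAt x0)
  refine hB.congr (Filter.Eventually.of_forall fun x => ?_)
  have : lastL (inj3 x) = 0 := inj_last x
  simp [prj_inj, this, hex]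

theorem analytic_helmholtz (k : ℝ) {f : EuclideanSpace ℝ (Fin 3) → ℂ} (hf : ContDiff ℝ 2 f)
    (hh : ∀ x, lap f x + (k:ℂ)^2 * f x = 0) (x0 : EuclideanSpace ℝ (Fin 3)) : AnalyticAt ℝ f x0 := by
  have h1 : AnalyticAt ℝ (fun x => Complex.reCLM (f x)) x0 := by
    refine analytic_helmholtz_real k (f := fun x => Complex.reCLM (f x))
      (Complex.reCLM.contDiff.comp hf) (fun x => ?_) x0
    rw [lap_clm hf]
    have := congrArg Complex.re (hh x)
    simpa [← Complex.ofReal_pow] using this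
  have h2 : AnalyticAt ℝ (fun x => Complex.imCLM (f x)) x0 := by
    refine analytic_helmholtz_real k (f := fun x => Complex.imCLM (f x))
      (Complex.imCLM.contDiff.comp hf) (fun x => ?_) x0
    rw [lap_clm hf]
    have := congrArg Complex.im (hh x)
    simpa [← Complex.ofReal_pow] using this
  have h3 : AnalyticAt ℝ (fun x => (Complex.ofRealCLM (Complex.reCLM (f x))) +
      (Complex.ofRealCLM (Complex.imCLM (f x))) * Complex.I) x0 :=
    ((Complex.ofRealCLM.analyticAt _).comp h1).add
      (((Complex.ofRealCLM.analyticAt _).comp h2).mul analyticAt_const)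
  refine h3.congr (Filter.Eventually.of_forall fun x => ?_)
  simp [Complex.re_add_im]

/-- smooth functions -/
abbrev Sm (f : EuclideanSpace ℝ (Fin 3) → ℂ) : Prop := ContDiff ℝ ((⊤ : ℕ∞) : WithTop ℕ∞) f

theorem Sm.pd {f : EuclideanSpace ℝ (Fin 3) → ℂ} (hf : Sm f) (v : EuclideanSpace ℝ (Fin 3)) :
    Sm (pd v f) := pd_contDiff hf (by simp) v

theorem Sm.two {f : EuclideanSpace ℝ (Fin 3) → ℂ} (hf : Sm f) : ContDiff ℝ 2 f :=
  contDiff_infty.1 hf 2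

theorem Sm.diff {f : EuclideanSpace ℝ (Fin 3) → ℂ} (hf : Sm f) : Differentiable ℝ f :=
  hf.differentiable (by simp)

theorem Sm.iter {f : EuclideanSpace ℝ (Fin 3) → ℂ} (hf : Sm f) (v : EuclideanSpace ℝ (Fin 3)) (n : ℕ) :
    Sm ((_root_.pd v)^[n] f) := by
  induction n generalizing f with
  | zero => exact hf
  | succ n ih => exact ih (hf.pd v)

theorem pd_iter_comm {f : EuclideanSpace ℝ (Fin 3) → ℂ} (hf : Sm f) (v w : EuclideanSpace ℝ (Fin 3))
    (n : ℕ) : (pd w)^[n] (pd v f) = pd v ((pd w)^[n] f) := by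
  induction n generalizing f with
  | zero => rfl
  | succ n ih =>
    rw [Function.iterate_succ_apply, Function.iterate_succ_apply, ← ih (hf.pd w), pd_comm hf.two]

theorem pd_iter_add {f g : EuclideanSpace ℝ (Fin 3) → ℂ} (hf : Sm f) (hg : Sm g)
    (v : EuclideanSpace ℝ (Fin 3)) (n : ℕ) :
    (pd v)^[n] (fun x => f x + g x) = fun x => (pd v)^[n] f x + (pd v)^[n] g x := by
  induction n generalizing f g with
  | zero => rfl
  | succ n ih =>
    simp only [Function.iterate_succ_apply]
    rw [pd_add hf.diff hg.diff, ih (hf.pd v) (hg.pd v)]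

theorem pd_iter_const_mul {f : EuclideanSpace ℝ (Fin 3) → ℂ} (hf : Sm f) (c : ℂ)
    (v : EuclideanSpace ℝ (Fin 3)) (n : ℕ) :
    (pd v)^[n] (fun x => c * f x) = fun x => c * (pd v)^[n] f x := by
  induction n generalizing f with
  | zero => rfl
  | succ n ih =>
    simp only [Function.iterate_succ_apply]
    rw [pd_const_mul hf.diff, ih (hf.pd v)]

/-- iterated partial derivative -/
noncomputable def DD (a b d : ℕ) (f : EuclideanSpace ℝ (Fin 3) → ℂ) : EuclideanSpace ℝ (Fin 3) → ℂ :=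
  (pd (ei 0))^[a] ((pd (ei 1))^[b] ((pd (ei 2))^[d] f))

theorem DD_sm {f : EuclideanSpace ℝ (Fin 3) → ℂ} (hf : Sm f) (a b d : ℕ) : Sm (DD a b d f) :=
  ((hf.iter _ _).iter _ _).iter _ _

theorem DD_add {f g : EuclideanSpace ℝ (Fin 3) → ℂ} (hf : Sm f) (hg : Sm g) (a b d : ℕ) :
    DD a b d (fun x => f x + g x) = fun x => DD a b d f x + DD a b d g x := by
  unfold DD
  rw [pd_iter_add hf hg, pd_iter_add (hf.iter _ _) (hg.iter _ _),
    pd_iter_add ((hf.iter _ _).iter _ _) ((hg.iter _ _).iter _ _)]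

theorem DD_const_mul {f : EuclideanSpace ℝ (Fin 3) → ℂ} (hf : Sm f) (c : ℂ) (a b d : ℕ) :
    DD a b d (fun x => c * f x) = fun x => c * DD a b d f x := by
  unfold DD
  rw [pd_iter_const_mul hf, pd_iter_const_mul (hf.iter _ _),
    pd_iter_const_mul ((hf.iter _ _).iter _ _)]

theorem DD_zero (a b d : ℕ) : DD a b d (fun _ => 0) = fun _ => 0 := by
  have := DD_const_mul (f := fun _ => 0) contDiff_const 0 a b d
  simpa using this

theorem DD_sum {ι : Type*} (s : Finset ι) {F : ι → EuclideanSpace ℝ (Fin 3) → ℂ} (hF : ∀ i, Sm (F i))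
    (a b d : ℕ) : DD a b d (fun x => ∑ i ∈ s, F i x) = fun x => ∑ i ∈ s, DD a b d (F i) x := by
  classical
  induction s using Finset.induction_on with
  | empty => simp [DD_zero]
  | insert i s hi ih =>
    simp only [Finset.sum_insert hi]
    rw [DD_add (hF i) (ContDiff.sum fun j _ => hF j), ih]

theorem DD_pd2 (a b d : ℕ) (f : EuclideanSpace ℝ (Fin 3) → ℂ) :
    DD a b d (pd (ei 2) f) = DD a b (d+1) f := rfl

theorem DD_pd1 {f : EuclideanSpace ℝ (Fin 3) → ℂ} (hf : Sm f) (a b d : ℕ) :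
    DD a b d (pd (ei 1) f) = DD a (b+1) d f := by
  unfold DD
  rw [pd_iter_comm hf]; rfl

theorem DD_pd0 {f : EuclideanSpace ℝ (Fin 3) → ℂ} (hf : Sm f) (a b d : ℕ) :
    DD a b d (pd (ei 0) f) = DD (a+1) b d f := by
  unfold DD
  rw [pd_iter_comm hf, pd_iter_comm (hf.iter _ _)]; rfl

theorem DD_lap {f : EuclideanSpace ℝ (Fin 3) → ℂ} (hf : Sm f) (a b d : ℕ) :
    DD a b d (lap f) = fun x => DD (a+2) b d f x + DD a (b+2) d f x + DD a b (d+2) f x := by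
  have e : lap f = fun x => (pd (ei 0) (pd (ei 0) f) x + pd (ei 1) (pd (ei 1) f) x) + pd (ei 2) (pd (ei 2) f) x := by
    ext x; simp [lap, Fin.sum_univ_three]
  have h := fun i : Fin 3 => (hf.pd (ei i)).pd (ei i)
  rw [e, DD_add ((h 0).add (h 1)) (h 2), DD_add (h 0) (h 1), DD_pd0 (hf.pd _), DD_pd0 hf,
    DD_pd1 (hf.pd _), DD_pd1 hf, DD_pd2, DD_pd2]

theorem vec_decomp (v : EuclideanSpace ℝ (Fin 3)) : v = ∑ i, v i • ei i := by
  ext j; simp [Pi.single_apply]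

theorem taylor_bound (n : ℕ) : ∀ f : EuclideanSpace ℝ (Fin 3) → ℂ, Sm f →
    (∀ a b d, a + b + d < n → DD a b d f 0 = 0) →
    ∃ C : ℝ, 0 ≤ C ∧ ∀ x, ‖x‖ ≤ 1 → ‖f x‖ ≤ C * ‖x‖^n := by
  induction n with
  | zero =>
    intro f hf _
    obtain ⟨C, hC⟩ := (isCompact_closedBall (0 : EuclideanSpace ℝ (Fin 3)) 1).exists_bound_of_continuousOn
      hf.continuous.continuousOn
    refine ⟨max C 0, le_max_right _ _, fun x hx => ?_⟩
    have := hC x (by simpa using hx)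
    simpa using Or.inl this
  | succ n ih =>
    intro f hf h
    have h0 : f 0 = 0 := h 0 0 0 (by omega)
    have hi : ∀ i : Fin 3, ∃ C : ℝ, 0 ≤ C ∧ ∀ x, ‖x‖ ≤ 1 → ‖pd (ei i) f x‖ ≤ C * ‖x‖^n := by
      intro i
      refine ih _ (hf.pd _) fun a b d habd => ?_
      fin_cases i
      · exact (congrFun (DD_pd0 hf a b d) 0).trans (h _ _ _ (by omega))
      · exact (congrFun (DD_pd1 hf a b d) 0).trans (h _ _ _ (by omega))
      · exact (congrFun (DD_pd2 a b d f) 0).trans (h _ _ _ (by omega))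
    choose C hC0 hC using hi
    have hCs : 0 ≤ ∑ i, C i := Finset.sum_nonneg fun i _ => hC0 i
    refine ⟨∑ i, C i, hCs, fun x hx => ?_⟩
    have hfd : ∀ y, ‖y‖ ≤ 1 → ‖fderiv ℝ f y‖ ≤ (∑ i, C i) * ‖y‖^n := by
      intro y hy
      refine ContinuousLinearMap.opNorm_le_bound _ (by positivity) fun v => ?_
      have e : fderiv ℝ f y v = ∑ i, v i • pd (ei i) f y := by
        conv_lhs => rw [vec_decomp v]
        simp [pd]
      rw [e, Finset.sum_mul, Finset.sum_mul]
      refine (norm_sum_le _ _).trans (Finset.sum_le_sum fun i _ => ?_)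
      rw [norm_smul, mul_comm]
      have := hC i y hy
      have h2 : ‖v i‖ ≤ ‖v‖ := PiLp.norm_apply_le v i
      have := hC0 i
      gcongr
    have hmv := (convex_closedBall (0 : EuclideanSpace ℝ (Fin 3)) ‖x‖).norm_image_sub_le_of_norm_fderiv_le
      (𝕜 := ℝ) (f := f) (C := (∑ i, C i) * ‖x‖^n) (fun y _ => hf.diff y) (fun y hy => by
        have hy' : ‖y‖ ≤ ‖x‖ := by simpa using hy
        refine (hfd y (hy'.trans hx)).trans ?_
        gcongr) (x := 0) (y := x) (by simp) (by simp)
    rw [h0, sub_zero, sub_zero] at hmv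
    rw [pow_succ, ← mul_assoc]; exact hmv

/-- shifted monomials -/
noncomputable def mm (j n : ℕ) : ℝ → ℂ := if j ≤ n then m1 (n - j) else fun _ => 0

theorem mm_contDiff (j n : ℕ) {m : WithTop ℕ∞} : ContDiff ℝ m (mm j n) := by
  unfold mm; split_ifs
  · exact m1_contDiff _
  · exact contDiff_const

theorem mm_deriv (j n : ℕ) (t : ℝ) : HasDerivAt (mm j n) (mm (j+1) n t) t := by
  by_cases h : j + 1 ≤ n
  · have e : n - j = (n - (j+1)) + 1 := by omega
    have := m1_deriv (n - (j+1)) t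
    rw [← e] at this
    simpa [mm, h, show j ≤ n by omega] using this
  · by_cases h2 : j = n
    · subst h2
      have : mm j j = fun _ => 1 := by ext t; simp [mm, m1]
      rw [this]; simp [mm, hasDerivAt_const]
    · have : mm j n = fun _ => 0 := by ext t; simp [mm, show ¬ j ≤ n by omega]
      rw [this]; simp [mm, h, hasDerivAt_const]

theorem mm_zero (j n : ℕ) : mm j n 0 = if n = j then 1 else 0 := by
  unfold mm
  by_cases h : n = j
  · subst h; simp [m1]
  · split_ifs with h1
    · have : n - j ≠ 0 := by omega
      simp [m1, this]
    · rfl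

/-- product of shifted monomials -/
noncomputable def mmp (i j l a b d : ℕ) (x : EuclideanSpace ℝ (Fin 3)) : ℂ :=
  mm i a (x 0) * mm j b (x 1) * mm l d (x 2)

theorem pd_mm (j n : ℕ) (i l : Fin 3) :
    pd (ei l) (fun x : EuclideanSpace ℝ (Fin 3) => mm j n (x i)) = fun x =>
      if i = l then mm (j+1) n (x i) else 0 := by
  have h := pd_comp_clm (f := mm j n) ((mm_contDiff j n (m := 1)).differentiable (by norm_num))
    (EuclideanSpace.proj (𝕜 := ℝ) i : EuclideanSpace ℝ (Fin 3) →L[ℝ] ℝ) (ei l)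
  refine h.trans ?_
  ext x
  simp only [pd, (mm_deriv j n _).hasFDerivAt.fderiv]
  by_cases hil : i = l <;> simp [hil, Pi.single_apply]

theorem pd_mmp (i j l a b d : ℕ) (r : Fin 3) :
    pd (ei r) (mmp i j l a b d) = ![mmp (i+1) j l a b d, mmp i (j+1) l a b d, mmp i j (l+1) a b d] r := by
  have hd : ∀ (j n : ℕ) (s : Fin 3), Differentiable ℝ (fun x : EuclideanSpace ℝ (Fin 3) => mm j n (x s)) :=
    fun j n s => ((mm_contDiff j n (m := 1)).comp
      (EuclideanSpace.proj (𝕜 := ℝ) s : EuclideanSpace ℝ (Fin 3) →L[ℝ] ℝ).contDiff).differentiable (by norm_num)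
  have hd2 : Differentiable ℝ (fun x : EuclideanSpace ℝ (Fin 3) => mm i a (x 0) * mm j b (x 1)) :=
    (hd i a 0).mul (hd j b 1)
  unfold mmp
  rw [pd_mul hd2 (hd l d 2), pd_mul (hd i a 0) (hd j b 1), pd_mm, pd_mm, pd_mm]
  fin_cases r <;> ext x <;> simp

theorem DD_mmp (a b d a' b' d' : ℕ) : DD a b d (mono a' b' d') = mmp a b d a' b' d' := by
  have e0 : mono a' b' d' = mmp 0 0 0 a' b' d' := by ext x; simp [mono, mmp, mm]
  have s2 : ∀ d i j l, (pd (ei 2))^[d] (mmp i j l a' b' d') = mmp i j (l+d) a' b' d' := by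
    intro d; induction d with
    | zero => intro i j l; rfl
    | succ d ih => intro i j l; rw [Function.iterate_succ_apply, pd_mmp]; simp [ih]; congr 1; omega
  have s1 : ∀ d i j l, (pd (ei 1))^[d] (mmp i j l a' b' d') = mmp i (j+d) l a' b' d' := by
    intro d; induction d with
    | zero => intro i j l; rfl
    | succ d ih => intro i j l; rw [Function.iterate_succ_apply, pd_mmp]; simp [ih]; congr 1; omega
  have s0 : ∀ d i j l, (pd (ei 0))^[d] (mmp i j l a' b' d') = mmp (i+d) j l a' b' d' := by
    intro d; induction d with
    | zero => intro i j l; rfl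
    | succ d ih => intro i j l; rw [Function.iterate_succ_apply, pd_mmp]; simp [ih]; congr 1; omega
  unfold DD
  rw [e0, s2, s1, s0]; simp

theorem DD_polyP (c : ℕ → ℕ → ℕ → ℂ) (N a b d : ℕ) (ha : a ≤ N) (hb : b ≤ N) (hd : d ≤ N) :
    DD a b d (polyP c N) 0 = c a b d := by
  have hsm : ∀ a b d, Sm (fun x => c a b d * mono a b d x) := fun a b d =>
    contDiff_const.mul (mono_contDiff a b d)
  unfold polyP
  rw [DD_sum _ (fun a' => ContDiff.sum fun b' _ => ContDiff.sum fun d' _ => hsm a' b' d')]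
  simp only [DD_sum _ (fun b' => ContDiff.sum fun d' _ => hsm _ b' d'), DD_sum _ (fun d' => hsm _ _ d'),
    DD_const_mul (mono_contDiff _ _ _), DD_mmp, mmp, PiLp.zero_apply, mm_zero]
  rw [Finset.sum_eq_single a, Finset.sum_eq_single b, Finset.sum_eq_single d]
  · simp
  · intro d' _ h; simp [h]
  · intro h; simp at h; omega
  · intro b' _ h; simp [h]
  · intro h; simp at h; omega
  · intro a' _ h; simp [h]
  · intro h; simp at h; omega

theorem zero_of_flat {f : EuclideanSpace ℝ (Fin 3) → ℂ} (ha : ∀ x, AnalyticAt ℝ f x) (hf : Sm f)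
    (h : ∀ a b d, DD a b d f 0 = 0) : ∀ x, f x = 0 := by
  intro x
  set g : ℝ → ℂ := fun t => f (t • x) with hg
  have hga : ∀ t, AnalyticAt ℝ g t := fun t => by
    have : AnalyticAt ℝ (fun t : ℝ => t • x) t := analyticAt_id.smul analyticAt_const
    exact AnalyticAt.comp_of_eq (ha (t • x)) this rfl
  have key : ∀ᶠ t in nhds (0:ℝ), g t = 0 := by
    by_contra hne
    obtain ⟨n, G, hG, hG0, hGe⟩ :=
      ((hga 0).exists_eventuallyEq_pow_smul_nonzero_iff).2 hne
    obtain ⟨C, hC, hCb⟩ := taylor_bound (n+1) f hf (fun a b d _ => h a b d)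
    have hsm : ∀ᶠ t : ℝ in nhds (0:ℝ), ‖t • x‖ ≤ 1 := by
      have : Continuous fun t : ℝ => ‖t • x‖ := by fun_prop
      exact (this.tendsto' 0 0 (by simp)).eventually (eventually_le_nhds (by norm_num))
    have hbd : ∀ᶠ t : ℝ in nhdsWithin (0:ℝ) {0}ᶜ, ‖G t‖ ≤ C * ‖x‖^(n+1) * |t| := by
      filter_upwards [hGe.filter_mono nhdsWithin_le_nhds, hsm.filter_mono nhdsWithin_le_nhds,
        self_mem_nhdsWithin] with t h1 h2 h3
      have h4 := hCb _ h2
      have h5 : f (t • x) = (t - 0)^n • G t := h1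
      rw [h5, norm_smul, norm_smul, sub_zero, norm_pow, mul_pow, Real.norm_eq_abs, pow_succ] at h4
      have h6 : 0 < |t|^n := pow_pos (abs_pos.2 h3) n
      have : |t|^n * ‖G t‖ ≤ |t|^n * (C * ‖x‖^(n+1) * |t|) := by
        calc _ ≤ _ := h4
          _ = _ := by ring
      exact le_of_mul_le_mul_left this h6
    have l1 : Filter.Tendsto (fun t => ‖G t‖) (nhdsWithin (0:ℝ) {0}ᶜ) (nhds ‖G 0‖) :=
      (hG.continuousAt.norm).tendsto.mono_left nhdsWithin_le_nhds
    have l2 : Filter.Tendsto (fun t : ℝ => C * ‖x‖^(n+1) * |t|) (nhdsWithin (0:ℝ) {0}ᶜ) (nhds 0) := by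
      have : Continuous fun t : ℝ => C * ‖x‖^(n+1) * |t| := by fun_prop
      exact (this.tendsto' 0 0 (by simp)).mono_left nhdsWithin_le_nhds
    have := le_of_tendsto_of_tendsto l1 l2 hbd
    exact hG0 (norm_le_zero_iff.1 this)
  have e : g = fun _ => 0 := by
    have h1 : AnalyticOnNhd ℝ g univ := fun t _ => hga t
    have h2 : AnalyticOnNhd ℝ (fun _ : ℝ => (0:ℂ)) univ := fun t _ => analyticAt_const
    exact h1.eq_of_eventuallyEq h2 key
  have := congrFun e 1
  simpa [hg] using this

theorem leading_part (k : ℝ) {f : EuclideanSpace ℝ (Fin 3) → ℂ} (hf2 : ContDiff ℝ 2 f)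
    (hh : ∀ x, lap f x + (k:ℂ)^2 * f x = 0) (hne : ¬ ∀ x, f x = 0) :
    ∃ (N : ℕ) (c : ℕ → ℕ → ℕ → ℂ), (∀ a b d, a+b+d ≠ N → c a b d = 0) ∧
      (∀ a b d, a+b+d+2 = N → c (a+2) b d + c a (b+2) d + c a b (d+2) = 0) ∧
      (¬ ∀ a b d, c a b d = 0) ∧
      ∃ C : ℝ, 0 ≤ C ∧ ∀ x, ‖x‖ ≤ 1 → ‖f x - polyP c N x‖ ≤ C * ‖x‖^(N+1) := by
  classical
  have ha := analytic_helmholtz k hf2 hh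
  have hf : Sm f := by
    exact contDiff_iff_contDiffAt.2 fun x => (ha x).contDiffAt
  have hex : ∃ N, ∃ a b d, a + b + d = N ∧ DD a b d f 0 ≠ 0 := by
    by_contra hcon
    push Not at hcon
    exact hne (zero_of_flat ha hf fun a b d => hcon _ a b d rfl)
  set N := Nat.find hex with hN
  have hlow : ∀ a b d, a + b + d < N → DD a b d f 0 = 0 := by
    intro a b d hlt
    by_contra hc
    exact Nat.find_min hex hlt ⟨a, b, d, rfl, hc⟩
  obtain ⟨a0, b0, d0, hs0, hn0⟩ := Nat.find_spec hex
  set c : ℕ → ℕ → ℕ → ℂ := fun a b d => if a + b + d = N then DD a b d f 0 else 0 with hc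
  refine ⟨N, c, fun a b d h => by simp [hc, h], ?_, ?_, ?_⟩
  · intro a b d h
    have e1 : lap f = fun x => (-(k:ℂ)^2) * f x := by
      ext x; linear_combination hh x
    have e2 := congrFun (DD_lap hf a b d) 0
    rw [e1, DD_const_mul hf] at e2
    simp only at e2
    rw [hlow a b d (by omega)] at e2
    simp only [hc]
    rw [if_pos (by omega), if_pos (by omega), if_pos (by omega), ← e2, mul_zero]
  · intro hz
    have := hz a0 b0 d0
    simp only [hc] at this
    rw [if_pos hs0] at this
    exact hn0 this
  · have hPs : Sm (polyP c N) := polyP_contDiff c N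
    have := taylor_bound (N+1) (fun x => f x + (-1) * polyP c N x) (hf.add (contDiff_const.mul hPs)) (by
      intro a b d hlt
      rw [DD_add hf (contDiff_const.mul hPs), DD_const_mul hPs]
      simp only
      rw [DD_polyP c N a b d (by omega) (by omega) (by omega)]
      simp only [hc]
      split_ifs with h
      · ring
      · rw [hlow a b d (by omega)]; ring)
    obtain ⟨C, hC, hb⟩ := this
    refine ⟨C, hC, fun x hx => ?_⟩
    have := hb x hx
    rwa [neg_one_mul, ← sub_eq_add_neg] at this

theorem lap_congr_nhds {f g : EuclideanSpace ℝ (Fin 3) → ℂ} {x : EuclideanSpace ℝ (Fin 3)}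
    (h : f =ᶠ[nhds x] g) : lap f x = lap g x := by
  unfold lap
  refine Finset.sum_congr rfl fun i _ => ?_
  have h1 : pd (ei i) f =ᶠ[nhds x] pd (ei i) g :=
    h.fderiv.mono fun y hy => by simp only [pd]; rw [hy]
  have h2 := Filter.EventuallyEq.fderiv_eq (𝕜 := ℝ) h1
  change fderiv ℝ (pd (ei i) f) x (ei i) = fderiv ℝ (pd (ei i) g) x (ei i)
  rw [h2]

theorem norm_le_sL {x : EuclideanSpace ℝ (Fin 3)} (hx : x ∈ octant) : ‖x‖ ≤ sL x := by
  rw [EuclideanSpace.norm_eq, sL_apply]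
  apply Real.sqrt_le_iff.2
  refine ⟨Finset.sum_nonneg fun i _ => hx i, ?_⟩
  simp only [Fin.sum_univ_three, Real.norm_eq_abs, sq_abs]
  have h0 := hx 0
  have h1 := hx 1
  have h2 := hx 2
  nlinarith [mul_nonneg h0 h1, mul_nonneg h0 h2, mul_nonneg h1 h2]

theorem main_aux
    (k : ℝ) (hk : 0 < k)
    (q : EuclideanSpace ℝ (Fin 3) → ℂ)
    (hqbdd : ∃ M : ℝ, ∀ x, ‖q x‖ ≤ M)
    (hqHolder : ∃ r > (0 : ℝ), ∃ α > (1 / 4 : ℝ), ∃ C ≥ (0 : ℝ),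
      ∀ x ∈ octant ∩ ball 0 r, ∀ y ∈ octant ∩ ball 0 r,
        ‖q x - q y‖ ≤ C * ‖x - y‖ ^ α)
    (hqO : q 0 ≠ 1)
    (u uin : EuclideanSpace ℝ (Fin 3) → ℂ)
    (husmooth : ContDiff ℝ 2 u) (huinsmooth : ContDiff ℝ 2 uin)
    (huinpde : ∀ x, lap uin x + (k : ℂ) ^ 2 * uin x = 0)
    (hupde : ∀ x, lap u x + (k : ℂ) ^ 2 * q x * u x = 0)
    (heq : ∀ x, x ∉ octant → u x = uin x) :
    ∀ x, uin x = 0 := by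
  by_contra hne
  obtain ⟨N, c, hdeg, hharm, hcne, C0, hC0, hT⟩ := leading_part k huinsmooth huinpde hne
  obtain ⟨M, hM⟩ := hqbdd
  obtain ⟨r, hr, α, hα, C, hC, hH⟩ := hqHolder
  obtain ⟨κ', hκ'0, hκ'⟩ := polyP_le c N hdeg
  have hM0 : 0 ≤ M := (norm_nonneg _).trans (hM 0)
  set P := polyP c N with hPdef
  set κ : ℂ := (k:ℂ)^2 * (1 - q 0) with hκ
  have hκ0 : κ ≠ 0 := mul_ne_zero (pow_ne_zero _ (by exact_mod_cast hk.ne')) (sub_ne_zero.2 hqO.symm)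
  apply hcne
  let χ : ContDiffBump (0 : EuclideanSpace ℝ (Fin 3)) := ⟨r/2, r, by linarith, by linarith⟩
  set w : EuclideanSpace ℝ (Fin 3) → ℂ := fun x => u x - uin x with hw
  have hw2 : ContDiff ℝ 2 w := husmooth.sub huinsmooth
  set v : EuclideanSpace ℝ (Fin 3) → ℂ := fun x => ((χ x : ℝ) : ℂ) * w x with hv
  have hχ2 : ContDiff ℝ 2 (fun x => ((χ x : ℝ) : ℂ)) :=
    Complex.ofRealCLM.contDiff.comp χ.contDiff
  have hv2 : ContDiff ℝ 2 v := hχ2.mul hw2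
  have hχc : HasCompactSupport (fun x => ((χ x : ℝ) : ℂ)) :=
    χ.hasCompactSupport.comp_left (g := fun t : ℝ => (t:ℂ)) (by simp)
  have hvc : HasCompactSupport v := hχc.mul_right
  have hlc : HasCompactSupport (lap v) := lap_support hvc
  obtain ⟨L, hL⟩ := (lap_continuous hv2).bounded_above_of_compact_support hlc
  have hL0 : 0 ≤ L := (norm_nonneg _).trans (hL 0)
  have hk0 : (0:ℝ) ≤ k^2 := by positivity
  have hkn : ‖(k:ℂ)^2‖ = k^2 := by rw [norm_pow, Complex.norm_real, Real.norm_eq_abs, sq_abs]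
  apply coef_zero c N hdeg hharm
  intro ρ hρ hnull
  have hoct0 : (0 : EuclideanSpace ℝ (Fin 3)) ∈ octant := fun i => by simp
  have := laplace_vanish N r (k^2*M) κ' κ hr.le (by positivity) v P hv2 hvc ?_ ?_
    (polyP_contDiff (m := 2) c N).continuous hκ' (polyP_smul c N hdeg) ?_ ρ hρ hnull
  · rw [hPdef, polyP_cE_integral c N ρ hρ] at this
    exact (mul_eq_zero.1 this).resolve_left hκ0
  · intro x hx
    by_contra hcon
    push Not at hcon
    apply hx
    have : χ x = 0 := χ.zero_of_le_dist (by rw [dist_zero_right]; exact hcon.le)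
    simp [hv, this]
  · intro x hx
    simp [hv, hw, heq x hx]
  · intro ε hε
    obtain ⟨δ, hδ, hδ1, hδr, hδε⟩ : ∃ δ > (0:ℝ), δ ≤ 1 ∧ δ ≤ r/2 ∧
        ∀ t, 0 ≤ t → t < δ → k^2 * κ' * (C * t^α) ≤ ε := by
      have hc : ContinuousAt (fun t : ℝ => k^2 * κ' * (C * t^α)) 0 :=
        continuousAt_const.mul (continuousAt_const.mul
          (Real.continuousAt_rpow_const 0 α (Or.inr (by linarith))))
      have hz : k^2 * κ' * (C * (0:ℝ)^α) = 0 := by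
        rw [Real.zero_rpow (by linarith)]; ring
      have he : ∀ᶠ t in nhds (0:ℝ), k^2 * κ' * (C * t^α) < ε :=
        hc.eventually (gt_mem_nhds (by simpa only [hz] using hε))
      obtain ⟨d, hd, hdb⟩ := Metric.eventually_nhds_iff.1 he
      refine ⟨min d (min 1 (r/2)), by positivity, (min_le_right _ _).trans (min_le_left _ _),
        (min_le_right _ _).trans (min_le_right _ _), fun t ht htd => ?_⟩
      refine (hdb ?_).le
      rw [Real.dist_eq, sub_zero, abs_of_nonneg ht]
      exact htd.trans_le (min_le_left _ _)
    refine ⟨k^2*(1+M)*C0 + (L/δ^(N+1) + ‖κ‖*κ'/δ), fun x hx => ?_⟩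
    have hs0 := sL_nonneg hx
    have hns := norm_le_sL hx
    have hP := hκ' x hx
    rcases lt_or_ge ‖x‖ δ with hlt | hge
    · have hve : v =ᶠ[nhds x] w := by
        have : ball (0 : EuclideanSpace ℝ (Fin 3)) (r/2) ∈ nhds x :=
          isOpen_ball.mem_nhds (by rw [mem_ball_zero_iff]; linarith)
        filter_upwards [this] with y hy
        have h1 : χ y = 1 := χ.one_of_mem_closedBall (ball_subset_closedBall hy)
        simp [hv, h1]
      have hvx : v x = w x := hve.self_of_nhds
      have hl : lap v x = -(k:ℂ)^2 * q x * v x + (k:ℂ)^2 * (1 - q x) * uin x := by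
        rw [lap_congr_nhds hve, hw, lap_sub husmooth huinsmooth]
        simp only
        rw [hvx, hw]
        linear_combination hupde x - huinpde x
      have e : lap v x - κ * P x = -((k:ℂ)^2 * q x * v x) + (k:ℂ)^2 * (1 - q x) * (uin x - P x)
          + (k:ℂ)^2 * (q 0 - q x) * P x := by
        rw [hl, hκ]; ring
      have n1 : ‖-((k:ℂ)^2 * q x * v x)‖ ≤ k^2 * M * ‖v x‖ := by
        rw [norm_neg, norm_mul, norm_mul, hkn]
        gcongr
        exact hM x
      have n2 : ‖(k:ℂ)^2 * (1 - q x) * (uin x - P x)‖ ≤ k^2*(1+M)*C0 * sL x^(N+1) := by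
        rw [norm_mul, norm_mul, hkn, mul_assoc _ C0]
        have a1 : ‖1 - q x‖ ≤ 1 + M := (norm_sub_le _ _).trans (by
          rw [norm_one]; linarith [hM x])
        have a2 : ‖uin x - P x‖ ≤ C0 * sL x^(N+1) := (hT x (by linarith)).trans (by gcongr)
        gcongr
      have n3 : ‖(k:ℂ)^2 * (q 0 - q x) * P x‖ ≤ ε * sL x^N := by
        rw [norm_mul, norm_mul, hkn]
        have a1 : ‖q 0 - q x‖ ≤ C * ‖x‖^α := by
          have := hH 0 ⟨hoct0, by simpa using hr⟩ x ⟨hx, by rw [mem_ball_zero_iff]; linarith⟩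
          rwa [zero_sub, norm_neg] at this
        have a2 := hδε ‖x‖ (norm_nonneg _) hlt
        calc k^2 * ‖q 0 - q x‖ * ‖P x‖ ≤ k^2 * (C * ‖x‖^α) * (κ' * sL x^N) := by gcongr
          _ = k^2 * κ' * (C * ‖x‖^α) * sL x^N := by ring
          _ ≤ _ := by gcongr
      have n4 : 0 ≤ (L/δ^(N+1) + ‖κ‖*κ'/δ) * sL x^(N+1) := by positivity
      rw [e]
      refine (norm_add₃_le).trans ?_
      rw [add_mul]
      linarith
    · have hsd : δ ≤ sL x := hge.trans hns
      have n1 : L ≤ L/δ^(N+1) * sL x^(N+1) := by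
        rw [div_mul_eq_mul_div, le_div_iff₀ (by positivity)]
        gcongr
      have n2 : ‖κ * P x‖ ≤ ‖κ‖*κ'/δ * sL x^(N+1) := by
        rw [norm_mul, div_mul_eq_mul_div, le_div_iff₀ hδ]
        calc ‖κ‖ * ‖P x‖ * δ ≤ ‖κ‖ * (κ' * sL x^N) * sL x := by gcongr
          _ = _ := by ring
      have n3 : 0 ≤ k^2*(1+M)*C0 * sL x^(N+1) := by positivity
      have n4 : 0 ≤ k^2*M*‖v x‖ := by positivity
      have n5 : 0 ≤ ε * sL x^N := by positivity
      refine (norm_sub_le _ _).trans ?_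
      rw [add_mul, add_mul]
      linarith [hL x]

/-- Core of Theorem 1.4(a) (rectangular corner scattering in 3D): the corner of the
octant with a contrast that is `C^α`, `α > 1/4`, near the corner and jumps there
always scatters. -/
theorem rectangular_corner_scattering_3D
    (k : ℝ) (hk : 0 < k)
    (q : EuclideanSpace ℝ (Fin 3) → ℂ)
    (hqmeas : Measurable q) (hqbdd : ∃ M : ℝ, ∀ x, ‖q x‖ ≤ M)
    (hqout : ∀ x, x ∉ octant → q x = 1)
    (hqsupp : HasCompactSupport (fun x => q x - 1))
    (hqHolder : ∃ r > (0 : ℝ), ∃ α > (1 / 4 : ℝ), ∃ C ≥ (0 : ℝ),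
      ∀ x ∈ octant ∩ ball 0 r, ∀ y ∈ octant ∩ ball 0 r,
        ‖q x - q y‖ ≤ C * ‖x - y‖ ^ α)
    (hqO : q 0 ≠ 1)
    (u uin : EuclideanSpace ℝ (Fin 3) → ℂ)
    (husmooth : ContDiff ℝ 2 u) (huinsmooth : ContDiff ℝ 2 uin)
    (huinpde : ∀ x, laplacian3 uin x + (k : ℂ) ^ 2 * uin x = 0)
    (hupde : ∀ x, laplacian3 u x + (k : ℂ) ^ 2 * q x * u x = 0)
    (heq : ∀ x, x ∉ octant → u x = uin x) :
    ∀ x, uin x = 0 := by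
  exact main_aux k hk q hqbdd hqHolder hqO u uin husmooth huinsmooth huinpde hupde heq
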